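/- arXiv:math/9706213 — 5 statements merged into one kernel-verified Lean document; each statement's English description precedes it below -/
import Mathlib

section
/- There is no nonzero Jordan homomorphism Φ : ℓ∞(ℕ, B(H)) → B(H) which vanishes on every cofinite sequence all of whose coordinates are finite-rank operators. -/
open scoped ENNReal

namespace JordanAux

section alg
variable {R S : Type*} [Ring R] [Module ℂ R] [Ring S] [Module ℂ S]

lemma half {s : S} (h : s + s = 0) : s = 0 := by
  have h2 : (2 : ℂ) • s = 0 := by rw [two_smul, h]
  simpa using h2

lemma jord (Φ : R →ₗ[ℂ] S) (hj : ∀ x, Φ (x * x) = Φ x * Φ x) (x y : R) :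
    Φ (x * y + y * x) = Φ x * Φ y + Φ y * Φ x := by
  have h := hj (x + y)
  have e : (x + y) * (x + y) = x * x + (x * y + y * x) + y * y := by noncomm_ring
  rw [e, map_add, map_add, hj, hj, map_add Φ x y] at h
  have e2 : (Φ x + Φ y) * (Φ x + Φ y) = Φ x * Φ x + (Φ x * Φ y + Φ y * Φ x) + Φ y * Φ y := by
    noncomm_ring
  rw [e2] at h
  exact add_left_cancel (add_right_cancel h)

lemma kerJ (Φ : R →ₗ[ℂ] S) (hj : ∀ x, Φ (x * x) = Φ x * Φ x) (x a : R) (ha : Φ a = 0) :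
    Φ (x * a + a * x) = 0 := by
  rw [jord Φ hj, ha]; simp

lemma kerQ (Φ : R →ₗ[ℂ] S) (hj : ∀ x, Φ (x * x) = Φ x * Φ x) (x a : R) (ha : Φ a = 0) :
    Φ (x * a * x) = 0 := by
  apply half
  rw [← map_add]
  have e : x * a * x + x * a * x =
      (x * (x * a + a * x) + (x * a + a * x) * x) - ((x * x) * a + a * (x * x)) := by
    noncomm_ring
  rw [e, map_sub, kerJ Φ hj _ _ (kerJ Φ hj _ _ ha), kerJ Φ hj _ _ ha, sub_zero]

lemma kerT (Φ : R →ₗ[ℂ] S) (hj : ∀ x, Φ (x * x) = Φ x * Φ x) (x z a : R) (ha : Φ a = 0) :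
    Φ (x * a * z + z * a * x) = 0 := by
  have e : x * a * z + z * a * x = (x + z) * a * (x + z) - x * a * x - z * a * z := by
    noncomm_ring
  rw [e, map_sub, map_sub, kerQ Φ hj _ _ ha, kerQ Φ hj _ _ ha, kerQ Φ hj _ _ ha]; simp

lemma zero_of (Φ : R →ₗ[ℂ] S) (hj : ∀ x, Φ (x * x) = Φ x * Φ x) (A B : R) (hBA : B * A = 1)
    (h : Φ (A * B) = 0) : Φ = 0 := by
  have hBA' : ∀ t, B * (A * t) = t := fun t => by rw [← mul_assoc, hBA, one_mul]
  have hQ : Φ (A * A * B * B) = 0 := by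
    apply half
    rw [← map_add]
    have e : A * A * B * B + A * A * B * B = (A * B) * (A * A * B * B) + (A * A * B * B) * (A * B) := by
      simp only [mul_assoc, hBA']
    rw [e, add_comm]
    exact kerJ Φ hj _ _ h
  have h1 : Φ 1 = 0 := by
    have := kerT Φ hj B A _ h
    have e : B * (A * B) * A + A * (A * B) * B = 1 + A * A * B * B := by
      simp only [mul_assoc, hBA', hBA]
    rwa [e, map_add, hQ, add_zero] at this
  ext x
  apply half
  have := kerJ Φ hj x 1 h1
  simpa using this

lemma orth {E F : S} (hE : E * E = E) (hF : E * F + F * E = 0) : E * F = 0 := by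
  have h1 : E * F + E * F * E = 0 := by
    have := congrArg (E * ·) hF
    simpa [mul_add, ← mul_assoc, hE] using this
  have h2 : E * F * E + F * E = 0 := by
    have := congrArg (· * E) hF
    simpa [add_mul, mul_assoc, hE] using this
  have h3 : E * F = F * E := by
    have := h1.trans h2.symm
    rw [add_comm (E * F * E)] at this
    exact add_right_cancel this
  rw [← h3] at hF
  exact half hF
end alg

lemma countable_idem {H : Type*} [NormedAddCommGroup H] [NormedSpace ℂ H]
    [TopologicalSpace.SeparableSpace H] {ι : Type*} (E : ι → H →L[ℂ] H)
    (hE : ∀ a, E a * E a = E a) (h0 : ∀ a, E a ≠ 0) (ho : ∀ a b, a ≠ b → E a * E b = 0) :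
    Countable ι := by
  have hx : ∀ a, ∃ x : H, ‖x‖ = 1 ∧ E a x = x := by
    intro a
    obtain ⟨y, hy⟩ : ∃ y, E a y ≠ 0 := by
      by_contra! h
      exact h0 a (by ext y; simpa using h y)
    refine ⟨((‖E a y‖⁻¹ : ℝ) : ℂ) • E a y, ?_, ?_⟩
    · rw [norm_smul]; simp [hy]
    · rw [map_smul]; congr 1
      exact congrArg (fun T : H →L[ℂ] H => T y) (hE a)
  choose x hx1 hx2 using hx
  have key : ∀ a b, a ≠ b → 1 ≤ ‖E a‖ * ‖x a - x b‖ := by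
    intro a b hab
    have h : E a (x a - x b) = x a := by
      rw [map_sub, hx2, ← hx2 b]
      have : E a (E b (x b)) = 0 := congrArg (fun T : H →L[ℂ] H => T (x b)) (ho a b hab)
      rw [this, sub_zero]
    calc 1 = ‖E a (x a - x b)‖ := by rw [h, hx1]
      _ ≤ _ := (E a).le_opNorm _
  have key2 : ∀ a b, a ≠ b → 1 / (‖E a‖ + 1) ≤ ‖x a - x b‖ := by
    intro a b hab
    rw [div_le_iff₀ (by positivity)]
    nlinarith [key a b hab, norm_nonneg (x a - x b)]
  have hd : (Set.univ : Set ι).PairwiseDisjoint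
      (fun a => Metric.ball (x a) (1 / (‖E a‖ + 1) / 2)) := by
    intro a _ b _ hab
    apply Metric.ball_disjoint_ball
    rw [dist_eq_norm]
    have h1 := key2 a b hab
    have h2 := key2 b a hab.symm
    rw [norm_sub_rev] at h2
    linarith
  have := hd.countable_of_isOpen (fun a _ => Metric.isOpen_ball)
    (fun a _ => ⟨x a, Metric.mem_ball_self (by positivity)⟩)
  exact Set.countable_univ_iff.mp this

section hil
variable {H : Type*} [NormedAddCommGroup H] [InnerProductSpace ℂ H] [CompleteSpace H]

noncomputable def V {ι : Type*} (b : HilbertBasis ι ℂ H) (f : ι → ι) (hf : f.Injective) :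
    H →ₗᵢ[ℂ] H :=
  ((b.orthonormal.comp f hf).orthogonalFamily.linearIsometry).comp b.repr.toLinearIsometry

lemma V_apply {ι : Type*} (b : HilbertBasis ι ℂ H) (f : ι → ι) (hf : f.Injective) (i : ι) :
    V b f hf (b i) = b (f i) := by
  classical
  have h : V b f hf (b i) =
      (b.orthonormal.comp f hf).orthogonalFamily.linearIsometry (b.repr (b i)) := rfl
  rw [h, b.repr_self, OrthogonalFamily.linearIsometry_apply_single]
  simp

noncomputable def A {ι : Type*} (b : HilbertBasis ι ℂ H) (f : ι → ι) (hf : f.Injective) :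
    H →L[ℂ] H := (V b f hf).toContinuousLinearMap

noncomputable def B {ι : Type*} (b : HilbertBasis ι ℂ H) (f : ι → ι) (hf : f.Injective) :
    H →L[ℂ] H := ContinuousLinearMap.adjoint (A b f hf)

lemma BA {ι : Type*} (b : HilbertBasis ι ℂ H) (f : ι → ι) (hf : f.Injective) :
    B b f hf * A b f hf = 1 := by
  ext x
  refine ext_inner_right ℂ fun y => ?_
  simp only [B, ContinuousLinearMap.mul_apply, ContinuousLinearMap.one_apply]
  rw [ContinuousLinearMap.adjoint_inner_left]
  exact (V b f hf).inner_map_map x y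

lemma norm_A {ι : Type*} (b : HilbertBasis ι ℂ H) (f : ι → ι) (hf : f.Injective) :
    ‖A b f hf‖ ≤ 1 := (V b f hf).norm_toContinuousLinearMap_le

lemma norm_B {ι : Type*} (b : HilbertBasis ι ℂ H) (f : ι → ι) (hf : f.Injective) :
    ‖B b f hf‖ ≤ 1 := by
  rw [B, LinearIsometryEquiv.norm_map]; exact norm_A b f hf

lemma hb_ext {ι : Type*} (b : HilbertBasis ι ℂ H) (x : H) (h : ∀ i, inner ℂ x (b i) = 0) :
    x = 0 := by
  have : b.repr x = 0 := by
    ext i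
    rw [b.repr_apply_apply, ← inner_conj_symm, h]; simp
  simpa using this

lemma B_zero {ι : Type*} (b : HilbertBasis ι ℂ H) (f : ι → ι) (hf : f.Injective) (j : ι)
    (hj : ∀ i, f i ≠ j) : B b f hf (b j) = 0 := by
  apply hb_ext b
  intro i
  rw [B, ContinuousLinearMap.adjoint_inner_left]
  have : A b f hf (b i) = b (f i) := V_apply b f hf i
  rw [this]
  exact b.orthonormal.2 (hj i).symm

lemma range_le {ι : Type*} (b : HilbertBasis ι ℂ H) (T : H →L[ℂ] H) (s : Set ι) (hs : s.Finite)
    (h : ∀ i, i ∉ s → T (b i) = 0) :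
    LinearMap.range (T : H →ₗ[ℂ] H) ≤ Submodule.span ℂ ((fun i => T (b i)) '' s) := by
  set W := Submodule.span ℂ ((fun i => T (b i)) '' s) with hW
  have : FiniteDimensional ℂ W := FiniteDimensional.span_of_finite ℂ (hs.image _)
  have hc : IsClosed (W : Set H) := W.closed_of_finiteDimensional
  have hc2 : IsClosed ((W.comap (T : H →ₗ[ℂ] H) : Submodule ℂ H) : Set H) :=
    hc.preimage T.continuous
  have h1 : Submodule.span ℂ (Set.range b) ≤ W.comap (T : H →ₗ[ℂ] H) := by
    rw [Submodule.span_le]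
    rintro _ ⟨i, rfl⟩
    show T (b i) ∈ W
    by_cases hi : i ∈ s
    · exact Submodule.subset_span ⟨i, hi, rfl⟩
    · rw [h i hi]; exact W.zero_mem
  have h2 := Submodule.topologicalClosure_minimal _ h1 hc2
  rw [b.dense_span] at h2
  rintro _ ⟨x, rfl⟩
  exact h2 (Submodule.mem_top : x ∈ ⊤)

lemma range_zero {ι : Type*} (b : HilbertBasis ι ℂ H) (T : H →L[ℂ] H)
    (h : ∀ i, T (b i) = 0) : T = 0 := by
  have := range_le b T ∅ Set.finite_empty (fun i _ => h i)
  ext x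
  have h2 := this ⟨x, rfl⟩
  simpa using h2

end hil

/-- branch code -/
def code (α : ℕ → Bool) (m : ℕ) : List Bool := (List.range m).map α

lemma code_eq {α β : ℕ → Bool} {m m' : ℕ} (h : code α m = code β m') :
    m = m' ∧ ∀ k < m, α k = β k := by
  have h1 : m = m' := by simpa [code] using congrArg List.length h
  subst h1
  refine ⟨rfl, fun k hk => ?_⟩
  simpa using (List.map_inj_left.mp h) k (by simpa using hk)

end JordanAux

open JordanAux in
/-- Let `H` be a complex separable infinite-dimensional Hilbert space.
There is no nonzero Jordan homomorphism `Φ : ℓ∞(ℕ, B(H)) → B(H)` which vanishes on every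
cofinite sequence all of whose coordinates are finite-rank operators. -/
theorem no_nonzero_jordan_hom_vanishing_on_finiteRank_cofinite
    {H : Type*} [NormedAddCommGroup H] [InnerProductSpace ℂ H] [CompleteSpace H]
    [TopologicalSpace.SeparableSpace H] [Nontrivial H]
    (hinf : ¬ FiniteDimensional ℂ H) :
    ¬ ∃ Φ : lp (fun _ : ℕ => H →L[ℂ] H) ∞ →ₗ[ℂ] (H →L[ℂ] H),
        (∀ x, Φ (x * x) = Φ x * Φ x) ∧ Φ ≠ 0 ∧
        ∀ x : lp (fun _ : ℕ => H →L[ℂ] H) ∞,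
          {n : ℕ | (x : ∀ _ : ℕ, H →L[ℂ] H) n ≠ 0}.Finite →
          (∀ n : ℕ, FiniteDimensional ℂ
            (LinearMap.range ((x : ∀ _ : ℕ, H →L[ℂ] H) n : H →ₗ[ℂ] H))) →
          Φ x = 0 := by
  rintro ⟨Φ, hj, hne, hker⟩
  obtain ⟨w, b, hb⟩ := exists_hilbertBasis ℂ H
  have hwinf : Infinite w := by
    by_contra hfin
    rw [not_infinite_iff_finite] at hfin
    apply hinf
    have hr := range_le b (1 : H →L[ℂ] H) Set.univ Set.finite_univ (by simp)
    have : FiniteDimensional ℂ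
        (Submodule.span ℂ ((fun i => (1 : H →L[ℂ] H) (b i)) '' Set.univ)) :=
      FiniteDimensional.span_of_finite ℂ (Set.finite_univ.image _)
    have htop : Submodule.span ℂ ((fun i => (1 : H →L[ℂ] H) (b i)) '' Set.univ) = ⊤ :=
      top_le_iff.mp (fun x _ => hr ⟨x, rfl⟩)
    have h3 : FiniteDimensional ℂ (⊤ : Submodule ℂ H) := by rw [← htop]; infer_instance
    exact Module.finite_def.mpr (Module.Finite.iff_fg.mp h3)
  have hwc : Countable w := by
    have hd : (Set.univ : Set w).PairwiseDisjoint (fun a => Metric.ball (b a) (1 / 2)) := by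
      intro i _ j _ hij
      apply Metric.ball_disjoint_ball
      rw [dist_eq_norm]
      have h2 : ‖b i - b j‖ ^ 2 = 2 := by
        rw [@norm_sub_sq ℂ, b.orthonormal.1, b.orthonormal.1, b.orthonormal.2 hij]
        norm_num
      nlinarith [norm_nonneg (b i - b j)]
    have := hd.countable_of_isOpen (fun a _ => Metric.isOpen_ball)
      (fun a _ => ⟨b a, Metric.mem_ball_self (by norm_num)⟩)
    exact Set.countable_univ_iff.mp this
  obtain ⟨d, hd⟩ := exists_injective_nat w
  obtain ⟨c, hc⟩ : ∃ c : List Bool → w, c.Injective := by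
    obtain ⟨e, he⟩ := exists_injective_nat (List Bool)
    exact ⟨fun l => Infinite.natEmbedding w (e l), (Infinite.natEmbedding w).injective.comp he⟩
  let f : (ℕ → Bool) → ℕ → w → w := fun α n i => c (code α (n + d i))
  have hf : ∀ α n, (f α n).Injective := by
    intro α n i j hij
    have := (code_eq (hc hij)).1
    exact hd (by omega)
  let a : (ℕ → Bool) → lp (fun _ : ℕ => H →L[ℂ] H) ∞ := fun α =>
    ⟨fun n => A b (f α n) (hf α n), memℓp_infty ⟨1, by
      rintro _ ⟨n, rfl⟩; exact norm_A _ _ _⟩⟩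
  let a' : (ℕ → Bool) → lp (fun _ : ℕ => H →L[ℂ] H) ∞ := fun α =>
    ⟨fun n => B b (f α n) (hf α n), memℓp_infty ⟨1, by
      rintro _ ⟨n, rfl⟩; exact norm_B _ _ _⟩⟩
  have haa : ∀ α, a' α * a α = 1 := by
    intro α
    ext1
    funext n
    exact BA b (f α n) (hf α n)
  have hdisj : ∀ α β, α ≠ β → Φ ((a α * a' α) * (a β * a' β)) = 0 := by
    intro α β hab
    obtain ⟨k, hk⟩ : ∃ k, α k ≠ β k := by
      by_contra! h; exact hab (funext h)
    have hz : ∀ n i, k < n + d i →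
        (B b (f α n) (hf α n) * A b (f β n) (hf β n)) (b i) = 0 := by
      intro n i hi
      have h1 : A b (f β n) (hf β n) (b i) = b (f β n i) := V_apply b (f β n) (hf β n) i
      rw [ContinuousLinearMap.mul_apply, h1]
      apply B_zero
      intro j hji
      obtain ⟨h2, h3⟩ := code_eq (hc hji)
      exact hk (h3 k (by omega))
    have hcoe : ∀ n, ((a α * a' α) * (a β * a' β) : lp (fun _ : ℕ => H →L[ℂ] H) ∞) n =
        A b (f α n) (hf α n) * (B b (f α n) (hf α n) * A b (f β n) (hf β n)) *
          B b (f β n) (hf β n) := by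
      intro n
      have : ((a α * a' α) * (a β * a' β) : lp (fun _ : ℕ => H →L[ℂ] H) ∞) n =
        (A b (f α n) (hf α n) * B b (f α n) (hf α n)) * (A b (f β n) (hf β n) *
          B b (f β n) (hf β n)) := rfl
      rw [this]
      simp only [mul_assoc]
    apply hker
    · apply (Set.finite_le_nat k).subset
      intro n hn
      by_contra hkn
      apply hn
      rw [hcoe, range_zero b _ (fun i => hz n i (by simp at hkn; omega))]
      simp
    · intro n
      rw [hcoe]
      set T := B b (f α n) (hf α n) * A b (f β n) (hf β n) with hT
      have hs : {i : w | d i ≤ k}.Finite := (Set.finite_le_nat k).preimage hd.injOn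
      have hr := range_le b T _ hs (fun i hi => hz n i (by simp at hi; omega))
      have : FiniteDimensional ℂ
          (Submodule.span ℂ ((fun i => T (b i)) '' {i : w | d i ≤ k})) :=
        FiniteDimensional.span_of_finite ℂ (hs.image _)
      refine Submodule.finiteDimensional_of_le (S₂ :=
        (Submodule.span ℂ ((fun i => T (b i)) '' {i : w | d i ≤ k})).map
          (A b (f α n) (hf α n) : H →ₗ[ℂ] H)) ?_
      rintro _ ⟨x, rfl⟩
      exact ⟨T (B b (f β n) (hf β n) x), hr ⟨_, rfl⟩, rfl⟩
  have hidem : ∀ α, Φ (a α * a' α) * Φ (a α * a' α) = Φ (a α * a' α) := by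
    intro α
    rw [← hj]
    congr 1
    rw [mul_assoc, ← mul_assoc (a' α), haa, one_mul]
  have hunc : Uncountable (ℕ → Bool) := by
    rw [← Cardinal.aleph0_lt_mk_iff]
    simpa using Cardinal.cantor Cardinal.aleph0
  have hcount : Countable (ℕ → Bool) := by
    refine countable_idem (fun α => Φ (a α * a' α)) hidem ?_ ?_
    · intro α h
      exact hne (zero_of Φ hj _ _ (haa α) h)
    · intro α β hab
      apply orth (hidem α)
      rw [← jord Φ hj, map_add, hdisj _ _ hab, hdisj _ _ hab.symm, add_zero]
  exact not_countable (α := ℕ → Bool)  hcount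
end

section
/- Let Φ : ℓ∞(ℕ, B(H)) → B(H) be an irreducible Jordan homomorphism, i.e. a Jordan homomorphism such that the only closed subspaces of H invariant under every operator in the range of Φ are {0} and H. Then there is a positive integer n such that ker Φ = { (A_k)_k ∈ ℓ∞(ℕ, B(H)) : A_n = 0 }. -/
open scoped ENNReal
section
variable {R B : Type*} [Ring R] [Algebra ℂ R] [Ring B] [Algebra ℂ B]

lemma jh2 (Φ : R →ₗ[ℂ] B) (hJ : ∀ x, Φ (x * x) = Φ x * Φ x) (a b : R) :
    Φ (a * b + b * a) = Φ a * Φ b + Φ b * Φ a := by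
  have h := hJ (a + b)
  simp only [mul_add, add_mul, map_add, hJ a, hJ b] at h ⊢
  have e : Φ a * Φ a + Φ (b * a) + (Φ (a * b) + Φ b * Φ b)
      = Φ a * Φ a + (Φ (a * b) + Φ (b * a)) + Φ b * Φ b := by abel
  have e' : Φ a * Φ a + Φ b * Φ a + (Φ a * Φ b + Φ b * Φ b)
      = Φ a * Φ a + (Φ a * Φ b + Φ b * Φ a) + Φ b * Φ b := by abel
  rw [e, e'] at h
  exact add_left_cancel (add_right_cancel h)

lemma jh3 (Φ : R →ₗ[ℂ] B) (hJ : ∀ x, Φ (x * x) = Φ x * Φ x) (a b : R) :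
    Φ (a * b * a) = Φ a * Φ b * Φ a := by
  have h1 := jh2 Φ hJ a (a * b + b * a)
  have h2 := jh2 Φ hJ (a * a) b
  rw [jh2 Φ hJ a b] at h1
  rw [hJ a] at h2
  have e : (2 : ℂ) • (a * b * a) = (a * (a * b + b * a) + (a * b + b * a) * a)
      - (a * a * b + b * (a * a)) := by
    rw [two_smul]; noncomm_ring
  have h3 : (2 : ℂ) • Φ (a * b * a) = (2 : ℂ) • (Φ a * Φ b * Φ a) := by
    rw [← map_smul, e, map_sub, h1, h2, two_smul]; noncomm_ring
  exact smul_right_injective B (two_ne_zero : (2 : ℂ) ≠ 0) h3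

lemma jh4 (Φ : R →ₗ[ℂ] B) (hJ : ∀ x, Φ (x * x) = Φ x * Φ x) (a b c : R) :
    Φ (a * b * c + c * b * a) = Φ a * Φ b * Φ c + Φ c * Φ b * Φ a := by
  have h := jh3 Φ hJ (a + c) b
  have e : (a + c) * b * (a + c) = a * b * a + c * b * c + (a * b * c + c * b * a) := by
    noncomm_ring
  rw [e, map_add, map_add, map_add, jh3 Φ hJ, jh3 Φ hJ] at h
  have : (Φ a + Φ c) * Φ b * (Φ a + Φ c) = Φ a * Φ b * Φ a + Φ c * Φ b * Φ c
    + (Φ a * Φ b * Φ c + Φ c * Φ b * Φ a) := by noncomm_ring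
  rw [map_add, this] at h
  rw [map_add]
  exact add_left_cancel h

/-- an idempotent equivalent to one is not killed -/
lemma jh_one (Φ : R →ₗ[ℂ] B) (hJ : ∀ x, Φ (x * x) = Φ x * Φ x) (v w : R) (hvw : v * w = 1)
    (h : Φ (w * v) = 0) : Φ 1 = 0 := by
  have h1 := jh4 Φ hJ v (w * v) w
  have h2 := jh3 Φ hJ (w * v) (w * w * v * v)
  have e1 : v * (w * v) * w = 1 := by
    rw [← mul_assoc, hvw, one_mul, hvw]
  have e2 : w * (w * v) * v = w * w * v * v := by noncomm_ring
  have e3 : (w * v) * (w * w * v * v) * (w * v) = w * w * v * v := by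
    calc (w * v) * (w * w * v * v) * (w * v) = w * (v * w) * w * v * (v * w) * v := by noncomm_ring
      _ = _ := by rw [hvw]; noncomm_ring
  rw [e3, h] at h2
  rw [e1, e2, map_add, h, h2] at h1
  simpa using h1

/-- the image of a central idempotent -/
lemma jh_comm (Φ : R →ₗ[ℂ] B) (hJ : ∀ x, Φ (x * x) = Φ x * Φ x) (e : R) (he : e * e = e)
    (hc : ∀ x, e * x = x * e) (x : R) : Φ e * Φ x = Φ x * Φ e ∧ Φ (e * x) = Φ e * Φ x := by
  have h1 := jh2 Φ hJ e x
  have h2 := jh3 Φ hJ e x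
  have hp : Φ e * Φ e = Φ e := by rw [← hJ, he]
  have e2 : e * x * e = e * x := by rw [hc x, mul_assoc, he]
  rw [e2] at h2
  rw [← hc x, map_add, h2] at h1
  have a1 : Φ e * Φ x = Φ e * Φ x * Φ e := by
    have := congrArg (fun z => Φ e * z) h1
    simp only [mul_add, ← mul_assoc, hp] at this
    exact (add_right_cancel this).symm
  have a2 : Φ x * Φ e = Φ e * Φ x * Φ e := by
    have := congrArg (fun z => z * Φ e) h1
    simp only [add_mul, mul_assoc, hp] at this
    simp only [mul_assoc]
    exact (add_left_cancel this).symm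
  exact ⟨a1.trans a2.symm, h2.trans a1.symm⟩

lemma idem_orth {B : Type*} [Ring B] (p q : B) (hp : p * p = p) (h : p * q + q * p = 0) (h2 : ∀ x : B, x + x = 0 → x = 0) :
    p * q = 0 := by
  have a1 : p * q + p * q * p = 0 := by
    have := congrArg (fun z => p * z) h
    simpa only [mul_add, ← mul_assoc, hp, mul_zero] using this
  have a2 : p * q * p + q * p = 0 := by
    have := congrArg (fun z => z * p) h
    simpa only [add_mul, mul_assoc, hp, zero_mul] using this
  have a3 : p * q = q * p := by
    rw [eq_neg_of_add_eq_zero_left a1, eq_neg_of_add_eq_zero_right a2]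
  rw [← a3] at h
  exact h2 _ h
end

section
variable {H : Type*} [NormedAddCommGroup H] [InnerProductSpace ℂ H]
    [TopologicalSpace.SeparableSpace H]

lemma countable_idem {I : Type*} (q : I → H →L[ℂ] H) (hq : ∀ i, q i * q i = q i)
    (h0 : ∀ i, q i ≠ 0) (ho : ∀ i j, i ≠ j → q i * q j = 0) : Countable I := by
  classical
  rcases isEmpty_or_nonempty I with hI | ⟨⟨i0⟩⟩
  · infer_instance
  have hv : ∀ i, ∃ v : H, ‖v‖ = 1 ∧ q i v = v := by
    intro i
    obtain ⟨u, hu⟩ : ∃ u, q i u ≠ 0 := by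
      by_contra! hh
      exact h0 i (ContinuousLinearMap.ext hh)
    refine ⟨((‖q i u‖⁻¹ : ℝ) : ℂ) • q i u, ?_, ?_⟩
    · rw [norm_smul]
      simp [hu]
    · rw [map_smul, ← mul_apply_eq_comp, hq]
  choose v hv1 hv2 using hv
  have hN : ∀ i, ∃ N : ℕ, ‖q i‖ ≤ N := fun i => exists_nat_ge _
  choose N hN using hN
  have hd : ∀ i, ∃ n : ℕ, dist (v i) (TopologicalSpace.denseSeq H n) < 1 / (3 * (N i + 1)) := by
    intro i
    obtain ⟨n, hy⟩ := (TopologicalSpace.denseRange_denseSeq H).exists_dist_lt (v i)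
      (ε := 1 / (3 * (N i + 1) : ℝ)) (by positivity)
    exact ⟨n, hy⟩
  choose n hn using hd
  have inj : Function.Injective (fun i => (N i, n i)) := by
    intro i j hij
    by_contra hne
    simp only [Prod.mk.injEq] at hij
    have h1 := hn i
    have h2 := hn j
    rw [← hij.1, ← hij.2] at h2
    have h3 : ‖v i - v j‖ ≤ 2 / (3 * (N i + 1)) := by
      rw [← dist_eq_norm]
      have := dist_triangle_right (v i) (v j) (TopologicalSpace.denseSeq H (n i))
      have e : (2 : ℝ) / (3 * (N i + 1)) = 1 / (3 * (N i + 1)) + 1 / (3 * (N i + 1)) := by ring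
      rw [e]; linarith
    have h4 : q i (v i - v j) = v i := by
      rw [map_sub, hv2 i, ← hv2 j, ← mul_apply_eq_comp, ho i j hne]; simp
    have h5 := (q i).le_opNorm (v i - v j)
    rw [h4, hv1] at h5
    have h6 : ‖q i‖ * ‖v i - v j‖ ≤ (N i + 1) * (2 / (3 * (N i + 1))) :=
      mul_le_mul ((hN i).trans (by linarith)) h3 (norm_nonneg _) (by positivity)
    have h7 : ((N i : ℝ) + 1) * (2 / (3 * (N i + 1))) = 2 / 3 := by field_simp
    linarith
  exact inj.countable

lemma jh_contra {R I : Type*} [Ring R] [Algebra ℂ R] (hI : ¬ Countable I)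
    (Φ : R →ₗ[ℂ] (H →L[ℂ] H)) (hJ : ∀ x, Φ (x * x) = Φ x * Φ x) (v w : I → R)
    (hvw : ∀ i, v i * w i = 1)
    (ho : ∀ i j, i ≠ j → Φ (w i * v i * (w j * v j)) = 0) : Φ 1 = 0 := by
  by_contra h1
  apply hI
  refine countable_idem (fun i => Φ (w i * v i)) ?_ ?_ ?_
  · intro i
    show Φ _ * Φ _ = Φ _
    rw [← hJ]
    congr 1
    rw [mul_assoc, ← mul_assoc (v i), hvw, one_mul]
  · intro i h
    exact h1 (jh_one Φ hJ _ _ (hvw i) h)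
  · intro i j hij
    refine idem_orth _ _ ?_ ?_ ?_
    · rw [← hJ]
      congr 1
      rw [mul_assoc, ← mul_assoc (v i), hvw, one_mul]
    · rw [← jh2 Φ hJ, map_add, ho i j hij, ho j i hij.symm, add_zero]
    · intro x hx
      rw [← two_smul ℂ] at hx
      simpa using hx
end

section
open InnerProductSpace ContinuousLinearMap
variable {H : Type*} [NormedAddCommGroup H] [InnerProductSpace ℂ H] [CompleteSpace H]

lemma exists_nat_basis [TopologicalSpace.SeparableSpace H] (hinf : ¬ FiniteDimensional ℂ H) :
    Nonempty (HilbertBasis ℕ ℂ H) := by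
  obtain ⟨w, b, hb⟩ := exists_hilbertBasis ℂ H
  have hc : Countable w := by
    refine countable_idem (fun i => rankOne ℂ (b i) (b i)) ?_ ?_ ?_
    · intro i
      exact isIdempotentElem_rankOne_self (b.orthonormal.1 i)
    · intro i
      have := b.orthonormal.ne_zero i
      exact rankOne_ne_zero this this
    · intro i j hij
      ext z
      simp [b.orthonormal.2 hij]
  have hi : Infinite w := by
    by_contra hfin
    rw [not_infinite_iff_finite] at hfin
    have := Fintype.ofFinite w
    exact hinf (b.toOrthonormalBasis.toBasis.finiteDimensional_of_finite)
  obtain ⟨d⟩ := nonempty_denumerable w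
  have e : ℕ ≃ w := (Denumerable.eqv w).symm
  refine ⟨HilbertBasis.mk (b.orthonormal.comp e e.injective) ?_⟩
  rw [e.surjective.range_comp, b.dense_span]

lemma ext_basis (b : HilbertBasis ℕ ℂ H) (S T : H →L[ℂ] H) (h : ∀ k, S (b k) = T (b k)) :
    S = T := by
  refine ContinuousLinearMap.ext_on (s := Set.range b) ?_ ?_
  · have := b.dense_span
    rw [Submodule.dense_iff_topologicalClosure_eq_top]
    exact this
  · rintro _ ⟨k, rfl⟩
    exact h k

lemma exists_shift (b : HilbertBasis ℕ ℂ H) (s : ℕ → ℕ) (hs : Function.Injective s) :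
    ∃ W : H →L[ℂ] H, (∀ k, W (b k) = b (s k)) ∧ adjoint W * W = 1 ∧ ‖W‖ ≤ 1 := by
  have hV := (b.orthonormal.comp s hs).orthogonalFamily
  let L : H →ₗᵢ[ℂ] H := hV.linearIsometry.comp b.repr.toLinearIsometry
  refine ⟨L.toContinuousLinearMap, ?_, ?_, L.norm_toContinuousLinearMap_le⟩
  · intro k
    show hV.linearIsometry (b.repr (b k)) = _
    rw [b.repr_self, hV.linearIsometry_apply_single]
    simp
  · exact (norm_map_iff_adjoint_comp_self _).1 (fun x => L.norm_map x)

lemma cross (b : HilbertBasis ℕ ℂ H) (s t : ℕ → ℕ) (S T : H →L[ℂ] H)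
    (hS : ∀ k, S (b k) = b (s k)) (hT : ∀ k, T (b k) = b (t k)) (N : ℕ)
    (h : ∀ j k, s j = t k → k < N) :
    adjoint S * T = ∑ k ∈ Finset.range N, rankOne ℂ ((adjoint S * T) (b k)) (b k) := by
  refine ext_basis b _ _ fun m => ?_
  simp only [sum_apply, rankOne_apply, orthonormal_iff_ite.1 b.orthonormal, ite_smul, one_smul,
    zero_smul, Finset.sum_ite_eq', Finset.mem_range]
  split_ifs with hm
  · rfl
  · refine b.repr.injective ?_
    ext j
    rw [b.repr_apply_apply]
    simp only [mul_apply_eq_comp, adjoint_inner_right, hS, hT, map_zero, lp.coeFn_zero,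
      Pi.zero_apply]
    exact b.orthonormal.2 (fun hh => hm (h _ _ hh))

/-- the code of the initial segment of length `n` -/
def initCode (α : ℕ → Bool) (n : ℕ) : ℕ := Encodable.encode ((List.range n).map α)

lemma initCode_eq {α β : ℕ → Bool} {m n : ℕ} (h : initCode α m = initCode β n) :
    m = n ∧ ∀ k < m, α k = β k := by
  have h1 := Encodable.encode_injective h
  have h2 : m = n := by simpa using congrArg List.length h1
  subst h2
  refine ⟨rfl, fun k hk => ?_⟩
  exact List.map_inj_left.1 h1 k (List.mem_range.2 hk)

lemma initCode_ne {α β : ℕ → Bool} (h : α ≠ β) :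
    ∃ N, ∀ m n, initCode α m = initCode β n → m = n ∧ n < N := by
  obtain ⟨k, hk⟩ := Function.ne_iff.1 h
  refine ⟨k + 1, fun m n hmn => ?_⟩
  obtain ⟨h1, h2⟩ := initCode_eq hmn
  refine ⟨h1, ?_⟩
  by_contra hn
  exact hk (h2 k (by omega))

lemma not_countable_cantor : ¬ Countable (ℕ → Bool) := by
  intro h
  have := Cardinal.mk_le_aleph0 (α := ℕ → Bool)
  simp only [Cardinal.mk_pi, Cardinal.mk_bool, Cardinal.prod_const, Cardinal.lift_id,
    Cardinal.mk_nat] at this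
  exact absurd this (not_le.2 (by simpa using Cardinal.cantor Cardinal.aleph0))

lemma rankOne_mem_ker (Ψ : (H →L[ℂ] H) →ₗ[ℂ] (H →L[ℂ] H))
    (hJ : ∀ x, Ψ (x * x) = Ψ x * Ψ x) (x : H →L[ℂ] H) (hx : x ≠ 0) (h0 : Ψ x = 0) (g f : H) :
    Ψ (rankOne ℂ g f) = 0 := by
  have key : ∀ p q r s : H, ∀ y : H →L[ℂ] H,
      rankOne ℂ p q * y * rankOne ℂ r s = (inner ℂ q (y r)) • rankOne ℂ p s := by
    intro p q r s y
    ext z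
    simp [smul_smul, mul_comm]
  obtain ⟨u, hu⟩ : ∃ u, x u ≠ 0 := by
    by_contra! hh
    exact hx (ContinuousLinearMap.ext hh)
  have step1 : ∀ e : H, Ψ (rankOne ℂ e e) = 0 := by
    intro e
    by_cases he : inner ℂ e (x e) = 0
    · have h := jh4 Ψ hJ (rankOne ℂ e (x u)) x (rankOne ℂ u e)
      rw [key, key, he, h0] at h
      simpa [hu] using h
    · have h := jh3 Ψ hJ (rankOne ℂ e e) x
      rw [key, h0] at h
      simpa [he] using h
  by_cases hg : g = 0
  · simp [hg]
  have h := jh4 Ψ hJ (rankOne ℂ g g) (rankOne ℂ g g) (rankOne ℂ g f)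
  rw [key, key, map_add, map_smul, map_smul, step1 g] at h
  have hg' : inner ℂ g ((rankOne ℂ g g) g) ≠ 0 := by
    simp [hg]
  have h' : inner ℂ g ((rankOne ℂ g g) g) • Ψ (rankOne ℂ g f) = 0 := by simpa only [smul_zero, add_zero, mul_zero, zero_mul] using h
  exact (smul_eq_zero.1 h').resolve_left hg'

lemma jh_injective [TopologicalSpace.SeparableSpace H] (b : HilbertBasis ℕ ℂ H)
    (Ψ : (H →L[ℂ] H) →ₗ[ℂ] (H →L[ℂ] H))
    (hJ : ∀ x, Ψ (x * x) = Ψ x * Ψ x) (h1 : Ψ 1 ≠ 0) (x : H →L[ℂ] H) (h0 : Ψ x = 0) :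
    x = 0 := by
  by_contra hx
  have hr := rankOne_mem_ker Ψ hJ x hx h0
  have hinj : ∀ α : ℕ → Bool, Function.Injective (initCode α) :=
    fun α m n h => (initCode_eq h).1
  choose W hW1 hW2 hW3 using fun α => exists_shift b (initCode α) (hinj α)
  refine h1 (jh_contra not_countable_cantor Ψ hJ (fun α => adjoint (W α)) W hW2 ?_)
  intro α β hab
  obtain ⟨N, hN⟩ := initCode_ne hab
  have hc := cross b _ _ (W α) (W β) (hW1 α) (hW1 β) N (fun j k h => (hN j k h).2)
  have e : W α * adjoint (W α) * (W β * adjoint (W β))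
      = W α * (adjoint (W α) * W β) * adjoint (W β) := by simp only [mul_assoc]
  rw [e, hc, Finset.mul_sum, Finset.sum_mul, map_sum]
  refine Finset.sum_eq_zero fun k _ => ?_
  rw [mul_def, mul_def, comp_rankOne, rankOne_comp]
  exact hr _ _
end

section
open ContinuousLinearMap

lemma irr_idem {H : Type*} [NormedAddCommGroup H] [InnerProductSpace ℂ H] {R : Type*}
    (Φ : R → (H →L[ℂ] H))
    (hirr : ∀ S : Submodule ℂ H, IsClosed (S : Set H) →
        (∀ (x : R), ∀ v ∈ S, Φ x v ∈ S) → S = ⊥ ∨ S = ⊤)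
    (p : H →L[ℂ] H) (hp : p * p = p) (hc : ∀ x, p * Φ x = Φ x * p) : p = 0 ∨ p = 1 := by
  rcases hirr p.ker p.isClosed_ker (by
    intro x v hv
    have hv' : p v = 0 := hv
    show p (Φ x v) = 0
    rw [← mul_apply_eq_comp, hc, mul_apply_eq_comp, hv', map_zero]) with h | h
  · right
    ext v
    have : p v - v ∈ p.ker := by
      show p (p v - v) = 0
      rw [map_sub, ← mul_apply_eq_comp, hp, sub_self]
    rw [h, Submodule.mem_bot, sub_eq_zero] at this
    exact this
  · left
    ext v
    have : v ∈ p.ker := by rw [h]; trivial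
    exact this

end

/-- Let `H` be a complex separable infinite-dimensional Hilbert space and
let `Φ : ℓ∞(ℕ, B(H)) → B(H)` be an irreducible Jordan homomorphism, i.e. a Jordan
homomorphism such that the only closed subspaces of `H` invariant under every operator in
the range of `Φ` are `{0}` and `H`. Then there is `n ∈ ℕ` such that
`ker Φ = { (A_k)_k : A_n = 0 }`. -/
theorem irreducible_jordan_hom_kernel
    {H : Type*} [NormedAddCommGroup H] [InnerProductSpace ℂ H] [CompleteSpace H]
    [TopologicalSpace.SeparableSpace H] [Nontrivial H]
    (hinf : ¬ FiniteDimensional ℂ H)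
    (Φ : lp (fun _ : ℕ => H →L[ℂ] H) ∞ →ₗ[ℂ] (H →L[ℂ] H))
    (hJ : ∀ x, Φ (x * x) = Φ x * Φ x)
    (hirr : ∀ S : Submodule ℂ H, IsClosed (S : Set H) →
        (∀ (x : lp (fun _ : ℕ => H →L[ℂ] H) ∞), ∀ v ∈ S, Φ x v ∈ S) →
        S = ⊥ ∨ S = ⊤) :
    ∃ n : ℕ, ∀ x : lp (fun _ : ℕ => H →L[ℂ] H) ∞,
      Φ x = 0 ↔ (x : ∀ _ : ℕ, H →L[ℂ] H) n = 0 := by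
  classical
  obtain ⟨b⟩ := exists_nat_basis hinf
  -- the image of the unit is nonzero
  have h1 : Φ 1 ≠ 0 := by
    intro h1
    have hz : ∀ x, Φ x = 0 := by
      intro x
      have := (jh_comm Φ hJ 1 (one_mul 1) (fun x => by rw [one_mul, mul_one]) x).2
      rwa [one_mul, h1, zero_mul] at this
    obtain ⟨u, hu⟩ := exists_ne (0 : H)
    rcases hirr (Submodule.span ℂ {u}) (Submodule.closed_of_finiteDimensional _)
      (fun x v _ => by rw [hz x]; simp) with h | h
    · exact hu (Submodule.span_singleton_eq_bot.1 h)
    · apply hinf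
      have : FiniteDimensional ℂ (⊤ : Submodule ℂ H) := by rw [← h]; infer_instance
      exact LinearEquiv.finiteDimensional (Submodule.topEquiv (R := ℂ) (M := H))
  -- central idempotents
  let χ : ℕ → lp (fun _ : ℕ => H →L[ℂ] H) ∞ := fun n => lp.single ∞ n 1
  have hsm : ∀ (n : ℕ) (x y : H →L[ℂ] H),
      (lp.single ∞ n (x * y) : lp (fun _ : ℕ => H →L[ℂ] H) ∞)
        = lp.single ∞ n x * lp.single ∞ n y := by
    intro n x y
    refine lp.ext ?_
    rw [lp.infty_coeFn_mul]
    simp only [lp.coeFn_single]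
    exact Pi.single_mul (α := fun _ : ℕ => H →L[ℂ] H) n x y
  have hχi : ∀ n, χ n * χ n = χ n := by
    intro n
    show lp.single ∞ n 1 * lp.single ∞ n 1 = lp.single ∞ n 1
    rw [← hsm, one_mul]
  have hχl : ∀ n x, χ n * x = lp.single ∞ n (x n) := by
    intro n x
    refine lp.ext ?_
    rw [lp.infty_coeFn_mul]
    funext k
    rw [Pi.mul_apply]
    by_cases hk : k = n
    · subst hk
      simp [χ]
    · simp [χ, hk]
  have hχr : ∀ n x, x * χ n = lp.single ∞ n (x n) := by
    intro n x
    refine lp.ext ?_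
    rw [lp.infty_coeFn_mul]
    funext k
    rw [Pi.mul_apply]
    by_cases hk : k = n
    · subst hk
      simp [χ]
    · simp [χ, hk]
  have hχc : ∀ n x, χ n * x = x * χ n := fun n x => by rw [hχl, hχr]
  have hcom := fun n => jh_comm Φ hJ (χ n) (hχi n) (hχc n)
  have hχ01 : ∀ n, Φ (χ n) = 0 ∨ Φ (χ n) = 1 := by
    intro n
    refine irr_idem Φ hirr _ ?_ (fun x => (hcom n x).1)
    rw [← hJ, hχi]
  have hne : (1 : H →L[ℂ] H) ≠ 0 := one_ne_zero
  by_cases hcase : ∃ n, Φ (χ n) = 1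
  · obtain ⟨n, hn⟩ := hcase
    refine ⟨n, fun x => ?_⟩
    have hx : Φ x = Φ (lp.single ∞ n (x n)) := by
      rw [← hχl, (hcom n x).2, hn, one_mul]
    constructor
    · intro h0
      refine jh_injective b (Φ ∘ₗ lp.lsingle (E := fun _ : ℕ => H →L[ℂ] H) (𝕜 := ℂ) ∞ n)
        ?_ ?_ (x n) ?_
      · intro y
        show Φ (lp.single ∞ n (y * y)) = Φ (lp.single ∞ n y) * Φ (lp.single ∞ n y)
        rw [hsm, hJ]
      · show Φ (χ n) ≠ 0
        rw [hn]; exact hne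
      · show Φ (lp.single ∞ n (x n)) = 0
        rw [← hx, h0]
    · intro h0
      rw [hx, h0, lp.single_zero, map_zero]
  · exfalso
    have hχ0 : ∀ n, Φ (χ n) = 0 := fun n =>
      (hχ01 n).resolve_right fun h => hcase ⟨n, h⟩
    have hsing : ∀ n a, Φ (lp.single ∞ n a) = 0 := by
      intro n a
      have := (hcom n (lp.single ∞ n a)).2
      rwa [hχl, hχ0, zero_mul, lp.single_apply_self] at this
    have hfin : ∀ (x : lp (fun _ : ℕ => H →L[ℂ] H) ∞) (N : ℕ), (∀ n, N ≤ n → x n = 0) →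
        Φ x = 0 := by
      intro x N hx
      have : x = ∑ n ∈ Finset.range N, lp.single ∞ n (x n) := by
        refine lp.ext ?_
        rw [lp.coeFn_sum]
        funext k
        rw [Finset.sum_apply]
        simp only [lp.coeFn_single, Finset.sum_pi_single]
        split_ifs with hk
        · rfl
        · exact hx k (by simpa using hk)
      rw [this, map_sum]
      exact Finset.sum_eq_zero fun n _ => hsing n _
    have hinj : ∀ (α : ℕ → Bool) (n : ℕ),
        Function.Injective (fun k => Nat.pair (initCode α n) k) := by
      intro α n k l h
      exact (Nat.pair_eq_pair.1 h).2
    choose W hW1 hW2 hW3 using fun α n => exists_shift b _ (hinj α n)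
    have hmW : ∀ α, Memℓp (E := fun _ : ℕ => H →L[ℂ] H) (fun n => W α n) ∞ := by
      intro α
      refine memℓp_infty ⟨1, ?_⟩
      rintro _ ⟨n, rfl⟩
      exact hW3 α n
    have hmV : ∀ α, Memℓp (E := fun _ : ℕ => H →L[ℂ] H)
        (fun n => ContinuousLinearMap.adjoint (W α n)) ∞ := by
      intro α
      refine memℓp_infty ⟨1, ?_⟩
      rintro _ ⟨n, rfl⟩
      show ‖ContinuousLinearMap.adjoint (W α n)‖ ≤ 1
      rw [LinearIsometryEquiv.norm_map]
      exact hW3 α n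
    let w : (ℕ → Bool) → lp (fun _ : ℕ => H →L[ℂ] H) ∞ := fun α => ⟨_, hmW α⟩
    let v : (ℕ → Bool) → lp (fun _ : ℕ => H →L[ℂ] H) ∞ := fun α => ⟨_, hmV α⟩
    refine h1 (jh_contra not_countable_cantor Φ hJ v w ?_ ?_)
    · intro α
      refine lp.ext ?_
      rw [lp.infty_coeFn_mul, lp.infty_coeFn_one]
      funext n
      exact hW2 α n
    · intro α β hab
      obtain ⟨N, hN⟩ := initCode_ne hab
      refine hfin _ N fun n hn => ?_
      simp only [lp.infty_coeFn_mul, Pi.mul_apply]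
      show W α n * ContinuousLinearMap.adjoint (W α n)
        * (W β n * ContinuousLinearMap.adjoint (W β n)) = 0
      have hc := cross b _ _ (W α n) (W β n) (hW1 α n) (hW1 β n) 0 (by
        intro j k h
        have := (hN n n (Nat.pair_eq_pair.1 h).1).2
        omega)
      rw [Finset.range_zero, Finset.sum_empty] at hc
      rw [mul_assoc, ← mul_assoc (ContinuousLinearMap.adjoint (W α n)), hc, zero_mul, mul_zero]
end

section
/- Let Φ : ℓ∞(ℕ, B(H)) → ℓ∞(ℕ, B(H)) be a bijective Jordan homomorphism (a bijective complex-linear map with Φ(A²) = Φ(A)² for all A). Then there are bijective Jordan homomorphisms φ_n of B(H) onto itself (n ∈ ℕ) and a bijection φ : ℕ → ℕ such that Φ((A_k)_k) = (φ_n(A_{φ(n)}))_n for every (A_k)_k ∈ ℓ∞(ℕ, B(H)). -/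
open scoped ENNReal

section JordanAux

variable {R : Type*} [NonUnitalRing R] [Module ℂ R]

theorem JAux.two_cancel {a b : R} (h : a + a = b + b) : a = b := by
  rw [← two_smul ℂ a, ← two_smul ℂ b] at h
  have := congrArg (fun x => (2⁻¹ : ℂ) • x) h
  simpa [smul_smul] using this

theorem JAux.map_jordan (Φ : R →ₗ[ℂ] R) (hJ : ∀ x, Φ (x * x) = Φ x * Φ x) (x y : R) :
    Φ (x * y + y * x) = Φ x * Φ y + Φ y * Φ x := by
  have h := hJ (x + y)
  simp only [add_mul, mul_add, map_add, hJ] at h ⊢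
  have h' : Φ x * Φ x + Φ y * Φ y + (Φ (x * y) + Φ (y * x)) =
      Φ x * Φ x + Φ y * Φ y + (Φ x * Φ y + Φ y * Φ x) := by
    calc _ = Φ x * Φ x + Φ (y * x) + (Φ (x * y) + Φ y * Φ y) := by abel
      _ = Φ x * Φ x + Φ y * Φ x + (Φ x * Φ y + Φ y * Φ y) := by
        exact h
      _ = _ := by abel
  exact add_left_cancel h'

theorem JAux.map_triple (Φ : R →ₗ[ℂ] R) (hJ : ∀ x, Φ (x * x) = Φ x * Φ x) (x y : R) :
    Φ (x * y * x) = Φ x * Φ y * Φ x := by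
  have key : ∀ a b : R, a * b * a + a * b * a =
      (a * (a * b + b * a) + (a * b + b * a) * a) - ((a * a) * b + b * (a * a)) := by
    intro a b; noncomm_ring
  apply JAux.two_cancel
  rw [← map_add, key, map_sub, JAux.map_jordan Φ hJ, JAux.map_jordan Φ hJ,
    JAux.map_jordan Φ hJ, hJ, key]

/-- Central idempotents. -/
def JAux.CI (p : R) : Prop := p * p = p ∧ ∀ x, p * x = x * p

theorem JAux.CI_map (Φ : R →ₗ[ℂ] R) (hs : Function.Surjective Φ)
    (hJ : ∀ x, Φ (x * x) = Φ x * Φ x) {p : R} (hp : JAux.CI p) : JAux.CI (Φ p) := by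
  have hid : Φ p * Φ p = Φ p := by rw [← hJ, hp.1]
  refine ⟨hid, fun y => ?_⟩
  obtain ⟨x, rfl⟩ := hs y
  have h : Φ p * Φ x + Φ x * Φ p = Φ p * Φ x * Φ p + Φ p * Φ x * Φ p := by
    rw [← JAux.map_jordan Φ hJ, ← JAux.map_triple Φ hJ, ← map_add, hp.2 x, mul_assoc, hp.1]
  have h1 := congrArg (fun z => Φ p * z) h
  have h2 := congrArg (fun z => z * Φ p) h
  simp only [mul_add, add_mul, ← mul_assoc, hid] at h1
  simp only [mul_add, add_mul, mul_assoc, hid] at h2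
  exact (add_right_cancel h1).trans ((mul_assoc _ _ _).trans (add_left_cancel h2).symm)

theorem JAux.CI_mul (Φ : R →ₗ[ℂ] R) (hs : Function.Surjective Φ)
    (hJ : ∀ x, Φ (x * x) = Φ x * Φ x) {p : R} (hp : JAux.CI p) (x : R) :
    Φ (p * x) = Φ p * Φ x := by
  have h := JAux.map_triple Φ hJ p x
  have hq := JAux.CI_map Φ hs hJ hp
  rwa [hp.2 x, mul_assoc, hp.1, ← hp.2 x, hq.2 (Φ x), mul_assoc, hq.1, ← hq.2 (Φ x)] at h

end JordanAux

section LpAux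

variable {H : Type*} [NormedAddCommGroup H] [InnerProductSpace ℂ H]

theorem JAux.CI_op {p : H →L[ℂ] H} (hp : JAux.CI p) : p = 0 ∨ p = 1 := by
  have hc : p ∈ Subalgebra.center ℂ (H →L[ℂ] H) :=
    Subalgebra.mem_center_iff.mpr fun x => (hp.2 x).symm
  rw [Algebra.IsCentral.center_eq_bot, Algebra.mem_bot] at hc
  obtain ⟨c, rfl⟩ := hc
  by_cases h : c = 0
  · left; simp [h]
  · right
    have h1 := hp.1
    rw [Algebra.algebraMap_eq_smul_one] at h1 ⊢
    have h2 := congrArg (fun z => c⁻¹ • z) h1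
    simpa [smul_smul, h] using h2

theorem JAux.single_mul (k : ℕ) (A : H →L[ℂ] H) (x : lp (fun _ : ℕ => H →L[ℂ] H) ∞) :
    lp.single ∞ k A * x = lp.single ∞ k (A * x k) := by
  ext1; funext n
  rw [lp.infty_coeFn_mul, Pi.mul_apply]
  by_cases h : n = k
  · subst h; rw [lp.single_apply_self, lp.single_apply_self]
  · rw [lp.single_apply_ne _ _ _ h, lp.single_apply_ne _ _ _ h, zero_mul]

theorem JAux.mul_single (k : ℕ) (A : H →L[ℂ] H) (x : lp (fun _ : ℕ => H →L[ℂ] H) ∞) :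
    x * lp.single ∞ k A = lp.single ∞ k (x k * A) := by
  ext1; funext n
  rw [lp.infty_coeFn_mul, Pi.mul_apply]
  by_cases h : n = k
  · subst h; rw [lp.single_apply_self, lp.single_apply_self]
  · rw [lp.single_apply_ne _ _ _ h, lp.single_apply_ne _ _ _ h, mul_zero]

/-- The unit of the `k`-th summand. -/
noncomputable def JAux.E (H : Type*) [NormedAddCommGroup H] [InnerProductSpace ℂ H] (k : ℕ) :
    lp (fun _ : ℕ => H →L[ℂ] H) ∞ := lp.single ∞ k 1

theorem JAux.E_mul (k : ℕ) (x : lp (fun _ : ℕ => H →L[ℂ] H) ∞) :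
    JAux.E H k * x = lp.single ∞ k (x k) := by
  rw [JAux.E, JAux.single_mul, one_mul]

theorem JAux.CI_E (k : ℕ) : JAux.CI (JAux.E H k) := by
  refine ⟨?_, fun x => ?_⟩
  · rw [JAux.E_mul, JAux.E, lp.single_apply_self]
  · rw [JAux.E_mul, JAux.E, JAux.mul_single, mul_one]

theorem JAux.CI_coord {p : lp (fun _ : ℕ => H →L[ℂ] H) ∞} (hp : JAux.CI p) (n : ℕ) :
    p n = 0 ∨ p n = 1 := by
  apply JAux.CI_op
  refine ⟨?_, fun A => ?_⟩
  · have := congrArg (fun z : lp (fun _ : ℕ => H →L[ℂ] H) ∞ => z n) hp.1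
    simpa only [lp.infty_coeFn_mul, Pi.mul_apply] using this
  · have := congrArg (fun z : lp (fun _ : ℕ => H →L[ℂ] H) ∞ => z n) (hp.2 (lp.single ∞ n A))
    simpa only [lp.infty_coeFn_mul, Pi.mul_apply, lp.single_apply_self] using this

theorem JAux.E_ne [Nontrivial H] (k : ℕ) : JAux.E H k ≠ 0 := by
  intro h
  have := congrArg (fun z : lp (fun _ : ℕ => H →L[ℂ] H) ∞ => z k) h
  simp only [JAux.E, lp.single_apply_self] at this
  exact one_ne_zero this

theorem JAux.E_inj [Nontrivial H] {k l : ℕ} (h : JAux.E H k = JAux.E H l) : k = l := by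
  by_contra hkl
  have := congrArg (fun z : lp (fun _ : ℕ => H →L[ℂ] H) ∞ => z k) h
  simp only [JAux.E, lp.single_apply_self, lp.single_apply_ne _ _ _ hkl] at this
  exact one_ne_zero this

theorem JAux.exists_E [Nontrivial H]
    (Φ : lp (fun _ : ℕ => H →L[ℂ] H) ∞ ≃ₗ[ℂ] lp (fun _ : ℕ => H →L[ℂ] H) ∞)
    (hJ : ∀ x, Φ (x * x) = Φ x * Φ x) (hJ' : ∀ x, Φ.symm (x * x) = Φ.symm x * Φ.symm x) (n : ℕ) :
    ∃ k, Φ (JAux.E H k) = JAux.E H n := by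
  have hq : JAux.CI (Φ.symm (JAux.E H n)) :=
    JAux.CI_map Φ.symm.toLinearMap Φ.symm.surjective hJ' (JAux.CI_E n)
  have hne : ∃ k, (Φ.symm (JAux.E H n)) k ≠ 0 := by
    by_contra hcon
    push Not at hcon
    have h0 : Φ.symm (JAux.E H n) = 0 := by
      ext1; funext k; rw [hcon k]; rfl
    exact JAux.E_ne n (Φ.symm.map_eq_zero_iff.mp h0)
  obtain ⟨k, hk⟩ := hne
  have hk1 := (JAux.CI_coord hq k).resolve_left hk
  have h1 : JAux.E H k * Φ.symm (JAux.E H n) = JAux.E H k := by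
    rw [JAux.E_mul, hk1]; rfl
  have h2 : Φ (JAux.E H k) * JAux.E H n = Φ (JAux.E H k) := by
    have := JAux.CI_mul Φ.toLinearMap Φ.surjective hJ (JAux.CI_E k) (Φ.symm (JAux.E H n))
    rw [h1] at this
    simpa using this.symm
  have hp : JAux.CI (Φ (JAux.E H k)) :=
    JAux.CI_map Φ.toLinearMap Φ.surjective hJ (JAux.CI_E k)
  refine ⟨k, ?_⟩
  rw [← (JAux.CI_E n).2, JAux.E_mul] at h2
  rcases JAux.CI_coord hp n with h | h
  · rw [h, lp.single_zero] at h2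
    exact absurd (Φ.map_eq_zero_iff.mp h2.symm) (JAux.E_ne (H := H) k)
  · rw [h] at h2
    exact h2.symm

end LpAux

/-- Let `H` be a complex separable infinite-dimensional Hilbert space and let
`Φ : ℓ∞(ℕ, B(H)) → ℓ∞(ℕ, B(H))` be a bijective Jordan homomorphism (a bijective
complex-linear map with `Φ(x²) = Φ(x)²`). Then there are bijective Jordan homomorphisms
`φ_n` of `B(H)` onto itself (`n ∈ ℕ`) and a bijection `φ : ℕ → ℕ` such that
`Φ((A_k)_k) = (φ_n(A_{φ(n)}))_n`. -/
theorem jordan_automorphism_of_linfty_form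
    {H : Type*} [NormedAddCommGroup H] [InnerProductSpace ℂ H] [CompleteSpace H]
    [TopologicalSpace.SeparableSpace H] [Nontrivial H]
    (hinf : ¬ FiniteDimensional ℂ H)
    (Φ : lp (fun _ : ℕ => H →L[ℂ] H) ∞ →ₗ[ℂ] lp (fun _ : ℕ => H →L[ℂ] H) ∞)
    (hbij : Function.Bijective Φ)
    (hJ : ∀ x, Φ (x * x) = Φ x * Φ x) :
    ∃ (ψ : ℕ → ((H →L[ℂ] H) →ₗ[ℂ] (H →L[ℂ] H))) (e : ℕ ≃ ℕ),
      (∀ n, Function.Bijective (ψ n) ∧ ∀ A : H →L[ℂ] H, ψ n (A * A) = ψ n A * ψ n A) ∧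
      ∀ (x : lp (fun _ : ℕ => H →L[ℂ] H) ∞) (n : ℕ),
        (Φ x : ∀ _ : ℕ, H →L[ℂ] H) n = ψ n ((x : ∀ _ : ℕ, H →L[ℂ] H) (e n)) := by
  let F := LinearEquiv.ofBijective Φ hbij
  have hF : ∀ x, F x = Φ x := fun _ => rfl
  have hJF : ∀ x, F (x * x) = F x * F x := hJ
  have hJF' : ∀ x, F.symm (x * x) = F.symm x * F.symm x := by
    intro x
    apply F.injective
    rw [hJF, F.apply_symm_apply, F.apply_symm_apply]
  choose f hf using JAux.exists_E F hJF hJF'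
  have hfbij : Function.Bijective f := by
    constructor
    · intro a b hab
      apply JAux.E_inj (H := H)
      rw [← hf a, ← hf b, hab]
    · intro k
      obtain ⟨n, hn⟩ := JAux.exists_E F.symm hJF' (by simpa using hJF) k
      refine ⟨n, JAux.E_inj (H := H) (F.injective ?_)⟩
      rw [hf, ← hn, F.apply_symm_apply]
  have hloc : ∀ (x : lp (fun _ : ℕ => H →L[ℂ] H) ∞) (n : ℕ),
      Φ (lp.single ∞ (f n) (x (f n))) = lp.single ∞ n (Φ x n) := by
    intro x n
    rw [← JAux.E_mul, ← JAux.E_mul, JAux.CI_mul Φ hbij.2 hJ (JAux.CI_E (f n)), ← hF, hf]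
  have hform : ∀ (x : lp (fun _ : ℕ => H →L[ℂ] H) ∞) (n : ℕ),
      Φ x n = Φ (lp.single ∞ (f n) (x (f n))) n := by
    intro x n
    rw [hloc, lp.single_apply_self]
  refine ⟨fun n =>
    { toFun := fun A => Φ (lp.single ∞ (f n) A) n
      map_add' := fun A B => by rw [lp.single_add, map_add]; rfl
      map_smul' := fun c A => by rw [lp.single_smul, map_smul]; rfl },
    Equiv.ofBijective f hfbij, fun n => ⟨⟨?_, ?_⟩, ?_⟩, fun x n => hform x n⟩
  · rw [injective_iff_map_eq_zero]
    intro A hA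
    have hA : Φ (lp.single ∞ (f n) A) n = 0 := hA
    have h := hloc (lp.single ∞ (f n) A) n
    rw [lp.single_apply_self, hA, lp.single_zero] at h
    have h0 := hbij.1 (h.trans (map_zero Φ).symm)
    have := congrArg (fun z : lp (fun _ : ℕ => H →L[ℂ] H) ∞ => z (f n)) h0
    simp only [lp.single_apply_self] at this
    exact this
  · intro B
    obtain ⟨x, hx⟩ := hbij.2 (lp.single ∞ n B)
    refine ⟨x (f n), ?_⟩
    change Φ (lp.single ∞ (f n) (x (f n))) n = B
    rw [← hform, hx, lp.single_apply_self]
  · intro A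
    change Φ (lp.single ∞ (f n) (A * A)) n =
      Φ (lp.single ∞ (f n) A) n * Φ (lp.single ∞ (f n) A) n
    have : lp.single ∞ (f n) (A * A) = lp.single ∞ (f n) A *
        (lp.single ∞ (f n) A : lp (fun _ : ℕ => H →L[ℂ] H) ∞) := by
      rw [JAux.single_mul, lp.single_apply_self]
    rw [this, hJ]
    rfl
end

section
/- Let Φ : ℓ∞(ℕ, B(H)) → ℓ∞(ℕ, B(H)) be a surjective linear isometry. Then there are surjective linear isometries ψ_n of B(H) (n ∈ ℕ) and a bijection φ : ℕ → ℕ such that Φ((A_k)_k) = (ψ_n(A_{φ(n)}))_n for every (A_k)_k ∈ ℓ∞(ℕ, B(H)). -/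
open scoped ENNReal

section Helpers

variable {H : Type*} [NormedAddCommGroup H] [InnerProductSpace ℂ H]

theorem aux_op_bound (u v : H) (hu : ‖u‖ = 1) (hv : ‖v‖ = 1) (A : H →L[ℂ] H)
    (hA : inner ℂ u (A v) = 0) (c : ℂ) :
    ‖InnerProductSpace.rankOne ℂ u v + c • A‖ ≤ 1 + ‖c‖ ^ 2 * ‖A‖ ^ 2 := by
  refine ContinuousLinearMap.opNorm_le_bound _ (by positivity) fun x => ?_
  set α : ℂ := inner ℂ v x with hα
  set w : H := x - α • v with hw
  have hvw : inner ℂ v w = 0 := by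
    rw [hw, inner_sub_right, inner_smul_right, inner_self_eq_norm_sq_to_K, hv]
    simp [hα]
  have hx : x = α • v + w := by simp [hw]
  have hxn : ‖x‖ ^ 2 = ‖α‖ ^ 2 + ‖w‖ ^ 2 := by
    rw [hx, @norm_add_sq ℂ, inner_smul_left, hvw, norm_smul, hv]
    simp
  have huA : inner ℂ u (A x) = inner ℂ u (A w) := by
    conv_lhs => rw [hx]
    rw [map_add, map_smul, inner_add_right, inner_smul_right, hA]
    simp
  have h1 : ‖inner ℂ u (A x)‖ ≤ ‖A‖ * ‖w‖ := by
    rw [huA]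
    calc ‖inner ℂ u (A w)‖ ≤ ‖u‖ * ‖A w‖ := norm_inner_le_norm _ _
      _ = ‖A w‖ := by rw [hu, one_mul]
      _ ≤ _ := A.le_opNorm w
  have h2 : RCLike.re (inner ℂ (α • u) (c • A x)) ≤ ‖α‖ * (‖c‖ * (‖A‖ * ‖w‖)) := by
    refine (RCLike.re_le_norm _).trans ?_
    rw [inner_smul_left, inner_smul_right, norm_mul, norm_mul, RCLike.norm_conj]
    gcongr
  have h3 : ‖c • A x‖ ≤ ‖c‖ * (‖A‖ * ‖x‖) := by
    rw [norm_smul]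
    gcongr
    exact A.le_opNorm x
  have h4 : ‖α • u + c • A x‖ ^ 2 ≤ ((1 + ‖c‖ ^ 2 * ‖A‖ ^ 2) * ‖x‖) ^ 2 := by
    rw [@norm_add_sq ℂ, norm_smul α u, hu, mul_one]
    have h5 : ‖c • A x‖ ^ 2 ≤ (‖c‖ * (‖A‖ * ‖x‖)) ^ 2 := by gcongr
    have h6 : 2 * (‖α‖ * (‖c‖ * (‖A‖ * ‖w‖))) ≤ ‖w‖ ^ 2 + (‖α‖ * ‖c‖ * ‖A‖) ^ 2 := by
      nlinarith [sq_nonneg (‖w‖ - ‖α‖ * ‖c‖ * ‖A‖)]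
    have h7 : (‖α‖ * ‖c‖ * ‖A‖) ^ 2 ≤ (‖x‖ * ‖c‖ * ‖A‖) ^ 2 := by
      have : ‖α‖ ≤ ‖x‖ := by
        apply le_of_sq_le_sq _ (norm_nonneg _)
        rw [hxn]; nlinarith [sq_nonneg ‖w‖]
      gcongr
    have h8 : 0 ≤ (‖c‖ ^ 2 * ‖A‖ ^ 2 * ‖x‖) ^ 2 := sq_nonneg _
    nlinarith
  have := le_of_sq_le_sq h4 (by positivity)
  simpa [InnerProductSpace.rankOne_apply, hα] using this

/-- Shorthand for the space of bounded sequences of operators. -/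
abbrev LB (H : Type*) [NormedAddCommGroup H] [InnerProductSpace ℂ H] : Type _ :=
  lp (fun _ : ℕ => H →L[ℂ] H) ∞

theorem aux_le (z : LB H) (n : ℕ) : ‖z n‖ ≤ ‖z‖ := lp.norm_apply_le_norm (by simp) z n

theorem aux_f_le (u v : H) (hu : ‖u‖ = 1) (hv : ‖v‖ = 1) (n : ℕ) (z : LB H) :
    ‖inner ℂ u (z n v)‖ ≤ ‖z‖ := by
  calc ‖inner ℂ u (z n v)‖ ≤ ‖u‖ * ‖z n v‖ := norm_inner_le_norm _ _
    _ = ‖z n v‖ := by rw [hu, one_mul]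
    _ ≤ ‖z n‖ * ‖v‖ := (z n).le_opNorm v
    _ ≤ ‖z‖ := by rw [hv, mul_one]; exact aux_le z n

theorem aux_lp_bound (u v : H) (hu : ‖u‖ = 1) (hv : ‖v‖ = 1) (n : ℕ) (y : LB H)
    (hy : inner ℂ u (y n v) = 0) (c : ℂ) :
    ‖(lp.single ∞ n (InnerProductSpace.rankOne ℂ u v) + c • y : LB H)‖
      ≤ 1 + ‖c‖ ^ 2 * ‖y‖ ^ 2 := by
  refine lp.norm_le_of_forall_le (by positivity) fun m => ?_
  by_cases hm : m = n
  · subst hm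
    have h := aux_op_bound u v hu hv (y m) hy c
    have h2 := aux_le y m
    have h3 : ‖c‖ ^ 2 * ‖y m‖ ^ 2 ≤ ‖c‖ ^ 2 * ‖y‖ ^ 2 := by gcongr
    simp only [lp.coeFn_add, lp.coeFn_smul, Pi.add_apply, Pi.smul_apply, lp.coeFn_single,
      Pi.single_eq_same]
    linarith
  · simp only [lp.coeFn_add, lp.coeFn_smul, Pi.add_apply, Pi.smul_apply, lp.coeFn_single,
      Pi.single_eq_of_ne hm, zero_add, norm_smul]
    have h2 := aux_le y m
    have h3 : ‖c‖ * ‖y m‖ ≤ ‖c‖ * ‖y‖ := by gcongr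
    nlinarith [sq_nonneg (‖c‖ * ‖y‖ - 1), sq_nonneg (‖c‖ * ‖y‖)]

/-- M-projections. -/
structure IsMProj (E : LB H →ₗ[ℂ] LB H) : Prop where
  idem : ∀ x, E (E x) = E x
  bound : ∀ x w, ‖E x + (w - E w)‖ ≤ max ‖x‖ ‖w‖

theorem aux_phase (E : LB H →ₗ[ℂ] LB H) (hE : IsMProj E) (u v : H) (hu : ‖u‖ = 1)
    (hv : ‖v‖ = 1) (n : ℕ) (x w : LB H) :
    ‖inner ℂ u (E x n v)‖ + ‖inner ℂ u ((w - E w) n v)‖ ≤ max ‖x‖ ‖w‖ := by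
  obtain ⟨c, hc, hc'⟩ := Complex.exists_norm_eq_mul_self (inner ℂ u (E x n v))
  obtain ⟨d, hd, hd'⟩ := Complex.exists_norm_eq_mul_self (inner ℂ u ((w - E w) n v))
  have h := hE.bound (c • x) (d • w)
  have h2 := aux_f_le u v hu hv n (E (c • x) + (d • w - E (d • w)))
  have h3 : inner ℂ u ((E (c • x) + (d • w - E (d • w)) : LB H) n v)
      = ((‖inner ℂ u (E x n v)‖ + ‖inner ℂ u ((w - E w) n v)‖ : ℝ) : ℂ) := by
    rw [Complex.ofReal_add, hc', hd', map_smul, map_smul, ← smul_sub]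
    simp only [lp.coeFn_add, lp.coeFn_smul, Pi.add_apply, Pi.smul_apply,
      _root_.add_apply, _root_.smul_apply, inner_add_right,
      inner_smul_right]
  rw [h3, Complex.norm_real, Real.norm_of_nonneg (by positivity)] at h2
  rw [norm_smul, norm_smul, hc, hd, one_mul, one_mul] at h
  exact h2.trans h

theorem aux_unit (E : LB H →ₗ[ℂ] LB H) (hE : IsMProj E) (u v : H) (hu : ‖u‖ = 1)
    (hv : ‖v‖ = 1) (n : ℕ) :
    (∀ x, inner ℂ u (E x n v) = inner ℂ u (x n v)) ∨ (∀ x, inner ℂ u (E x n v) = 0) := by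
  set T : LB H := lp.single ∞ n (InnerProductSpace.rankOne ℂ u v) with hT
  have hTn : ‖T‖ = 1 := by
    rw [hT, lp.norm_single (by simp), InnerProductSpace.norm_rankOne, hu, hv, one_mul]
  have hfT : inner ℂ u (T n v) = 1 := by
    rw [hT, lp.single_apply_self, InnerProductSpace.rankOne_apply, inner_smul_right,
      inner_self_eq_norm_sq_to_K, inner_self_eq_norm_sq_to_K, hu, hv]
    simp
  set l : ℂ := inner ℂ u (E T n v) with hl
  have hlT : inner ℂ u ((T - E T) n v) = 1 - l := by
    rw [lp.coeFn_sub, Pi.sub_apply, _root_.sub_apply, inner_sub_right, hfT]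
  have h1 : ‖l‖ + ‖1 - l‖ ≤ 1 := by
    have := aux_phase E hE u v hu hv n T T
    rwa [hlT, hTn, max_self] at this
  have hre : l = (‖l‖ : ℂ) := by
    have h2 : l.re ≤ ‖l‖ := Complex.re_le_norm l
    have h3 : (1 - l).re ≤ ‖1 - l‖ := Complex.re_le_norm _
    simp only [Complex.sub_re, Complex.one_re] at h3
    have h4 : l.re = ‖l‖ := by linarith
    have h5 : l.im = 0 := by
      have h6 := Complex.sq_norm l
      rw [Complex.normSq_apply, ← h4] at h6
      have h7 : l.im * l.im = 0 := by linarith [sq l.re]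
      exact mul_self_eq_zero.mp h7
    apply Complex.ext
    · rw [Complex.ofReal_re]; exact h4
    · rw [Complex.ofReal_im]; exact h5
  have h1l : 1 - ‖l‖ ≤ ‖1 - l‖ := by
    have := norm_sub_norm_le 1 l
    simpa using this
  have key : ∀ y : LB H, inner ℂ u (y n v) = 0 → inner ℂ u (E y n v) = 0 := by
    intro y hy
    set g : ℂ := inner ℂ u (E y n v) with hg
    by_contra hne
    have hgpos : 0 < ‖g‖ := norm_pos_iff.mpr hne
    have main : ∀ t : ℝ, 0 < t → t * ‖g‖ ^ 2 ≤ (t * ‖g‖) ^ 2 * ‖y‖ ^ 2 := by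
      intro t ht
      set c : ℂ := (t : ℂ) * (starRingEnd ℂ) g with hc
      have hcn : ‖c‖ = t * ‖g‖ := by
        rw [hc, norm_mul, Complex.norm_real, RCLike.norm_conj, Real.norm_of_nonneg ht.le]
      have hb := aux_lp_bound u v hu hv n y hy c
      have hp := aux_phase E hE u v hu hv n (T + c • y) T
      have hv1 : inner ℂ u (E (T + c • y) n v) = ((‖l‖ + t * ‖g‖ ^ 2 : ℝ) : ℂ) := by
        rw [map_add, map_smul]
        simp only [lp.coeFn_add, lp.coeFn_smul, Pi.add_apply, Pi.smul_apply,
          _root_.add_apply, _root_.smul_apply, inner_add_right,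
          inner_smul_right]
        rw [← hl, ← hg, hc, mul_assoc, ← Complex.normSq_eq_conj_mul_self, Complex.normSq_eq_norm_sq]
        push_cast
        rw [← hre]
      rw [hv1, hlT, Complex.norm_real, Real.norm_of_nonneg (by positivity), hTn] at hp
      have hm : max ‖T + c • y‖ 1 ≤ 1 + ‖c‖ ^ 2 * ‖y‖ ^ 2 :=
        max_le hb (by nlinarith [sq_nonneg (‖c‖ * ‖y‖)])
      rw [hcn] at hm
      linarith
    have hm := main (1 / (2 * (‖y‖ ^ 2 + 1))) (by positivity)
    set s := ‖y‖ ^ 2 with hs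
    have hs0 : 0 ≤ s := by positivity
    have h9 : (1 / (2 * (s + 1)) * ‖g‖) ^ 2 * s
        = (1 / (2 * (s + 1)) * ‖g‖ ^ 2) * (s / (2 * (s + 1))) := by
      field_simp
    rw [h9] at hm
    have h10 : s / (2 * (s + 1)) < 1 := by
      rw [div_lt_one (by positivity)]; linarith
    have h11 : 0 < 1 / (2 * (s + 1)) * ‖g‖ ^ 2 := by positivity
    nlinarith
  have hall : ∀ x : LB H, inner ℂ u (E x n v) = inner ℂ u (x n v) * l := by
    intro x
    have := key (x - (inner ℂ u (x n v) : ℂ) • T) (by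
      simp only [lp.coeFn_sub, lp.coeFn_smul, Pi.sub_apply, Pi.smul_apply,
        _root_.sub_apply, _root_.smul_apply, inner_sub_right,
        inner_smul_right, hfT, mul_one, sub_self])
    rw [map_sub, map_smul] at this
    simp only [lp.coeFn_sub, lp.coeFn_smul, Pi.sub_apply, Pi.smul_apply,
        _root_.sub_apply, _root_.smul_apply, inner_sub_right,
        inner_smul_right] at this
    rw [← hl] at this
    exact sub_eq_zero.mp this
  have hid : l = l * l := by
    have := hall (E T)
    rwa [hE.idem, ← hl] at this
  have : l = 0 ∨ l = 1 := by
    have h : l * (l - 1) = 0 := by linear_combination -hid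
    rcases mul_eq_zero.mp h with h | h
    · exact Or.inl h
    · exact Or.inr (sub_eq_zero.mp h)
  rcases this with h | h
  · right; intro x; rw [hall, h, mul_zero]
  · left; intro x; rw [hall, h, mul_one]

theorem aux_all (E : LB H →ₗ[ℂ] LB H) (hE : IsMProj E) (u v : H) (n : ℕ) :
    (∀ x, inner ℂ u (E x n v) = inner ℂ u (x n v)) ∨ (∀ x, inner ℂ u (E x n v) = 0) := by
  by_cases hu : u = 0
  · left; intro x; simp [hu]
  by_cases hv : v = 0
  · left; intro x; simp [hv]
  have hu' : (‖u‖ : ℂ) ≠ 0 := by simpa using hu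
  have hv' : (‖v‖ : ℂ) ≠ 0 := by simpa using hv
  have h := aux_unit E hE ((‖u‖ : ℂ)⁻¹ • u) ((‖v‖ : ℂ)⁻¹ • v)
    (norm_smul_inv_norm hu) (norm_smul_inv_norm hv) n
  simpa [inner_smul_left, inner_smul_right, hu', hv', hu, hv] using h

theorem aux_vec (E : LB H →ₗ[ℂ] LB H) (hE : IsMProj E) (v : H) (n : ℕ) :
    (∀ x, E x n v = x n v) ∨ (∀ x, E x n v = 0) := by
  by_contra! hcon
  obtain ⟨⟨x, hx⟩, y, hy⟩ := hcon
  have h1 : ∃ u : H, inner ℂ u (E x n v) ≠ inner ℂ u (x n v) := by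
    by_contra! h
    exact hx (ext_inner_left ℂ h)
  have h2 : ∃ u : H, inner ℂ u (E y n v) ≠ 0 := by
    by_contra! h
    exact hy (ext_inner_left ℂ (fun u => by rw [h u, inner_zero_right]))
  obtain ⟨a, ha⟩ := h1
  obtain ⟨b, hb⟩ := h2
  have ha0 := (aux_all E hE a v n).resolve_left (fun h => ha (h x))
  have hb1 := (aux_all E hE b v n).resolve_right (fun h => hb (h y))
  rcases aux_all E hE (a + b) v n with h | h
  · apply ha
    have := h x
    rw [inner_add_left, inner_add_left, hb1] at this
    exact add_right_cancel this
  · apply hb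
    have := h y
    rwa [inner_add_left, ha0, zero_add] at this

theorem aux_coord (E : LB H →ₗ[ℂ] LB H) (hE : IsMProj E) (n : ℕ) :
    (∀ x, E x n = x n) ∨ (∀ x, E x n = 0) := by
  by_contra! hcon
  obtain ⟨⟨x, hx⟩, y, hy⟩ := hcon
  have h1 : ∃ v : H, E x n v ≠ x n v := by
    by_contra! h
    exact hx (ContinuousLinearMap.ext h)
  have h2 : ∃ v : H, E y n v ≠ 0 := by
    by_contra! h
    exact hy (ContinuousLinearMap.ext h)
  obtain ⟨a, ha⟩ := h1
  obtain ⟨b, hb⟩ := h2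
  have ha0 := (aux_vec E hE a n).resolve_left (fun h => ha (h x))
  have hb1 := (aux_vec E hE b n).resolve_right (fun h => hb (h y))
  rcases aux_vec E hE (a + b) n with h | h
  · apply ha
    have := h x
    rw [map_add, map_add, hb1] at this
    exact add_right_cancel this
  · apply hb
    have := h y
    rwa [map_add, ha0, zero_add] at this

/-- The coordinate projection. -/
noncomputable def cproj (k : ℕ) : LB H →ₗ[ℂ] LB H where
  toFun x := lp.single ∞ k (x k)
  map_add' x y := by rw [lp.coeFn_add, Pi.add_apply, lp.single_add]
  map_smul' c x := by rw [lp.coeFn_smul, Pi.smul_apply, lp.single_smul]; rfl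

theorem cproj_same (k : ℕ) (x : LB H) : cproj k x k = x k := lp.single_apply_self _ _ _

theorem cproj_ne (k : ℕ) (x : LB H) {j : ℕ} (h : j ≠ k) : cproj k x j = 0 :=
  lp.single_apply_ne _ _ _ h

/-- Conjugated coordinate projection. -/
noncomputable def qproj (Φ : LB H ≃ₗᵢ[ℂ] LB H) (k : ℕ) : LB H →ₗ[ℂ] LB H where
  toFun x := Φ (cproj k (Φ.symm x))
  map_add' x y := by simp only [map_add]
  map_smul' c x := by simp only [map_smul, RingHom.id_apply]

theorem qproj_apply (Φ : LB H ≃ₗᵢ[ℂ] LB H) (k : ℕ) (x : LB H) :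
    qproj Φ k x = Φ (cproj k (Φ.symm x)) := rfl

theorem cproj_idem (k : ℕ) (x : LB H) : cproj k (cproj k x) = cproj k x := by
  refine lp.ext (funext fun j => ?_)
  by_cases hj : j = k
  · subst hj; rw [cproj_same]
  · rw [cproj_ne _ _ hj, cproj_ne _ _ hj]

theorem qproj_isMProj (Φ : LB H ≃ₗᵢ[ℂ] LB H) (k : ℕ) : IsMProj (qproj Φ k) where
  idem x := by
    simp only [qproj_apply, LinearIsometryEquiv.symm_apply_apply, cproj_idem]
  bound x w := by
    have h : qproj Φ k x + (w - qproj Φ k w)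
        = Φ (cproj k (Φ.symm x) + (Φ.symm w - cproj k (Φ.symm w))) := by
      simp only [qproj_apply, map_add, map_sub, LinearIsometryEquiv.apply_symm_apply]
    rw [h, LinearIsometryEquiv.norm_map]
    refine lp.norm_le_of_forall_le (by positivity) fun m => ?_
    rw [lp.coeFn_add, lp.coeFn_sub, Pi.add_apply, Pi.sub_apply]
    by_cases hm : m = k
    · subst hm
      rw [cproj_same, cproj_same, sub_self, add_zero]
      refine (aux_le _ m).trans ?_
      rw [LinearIsometryEquiv.norm_map]
      exact le_max_left _ _
    · rw [cproj_ne _ _ hm, cproj_ne _ _ hm, sub_zero, zero_add]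
      refine (aux_le _ m).trans ?_
      rw [LinearIsometryEquiv.norm_map]
      exact le_max_right _ _

theorem aux_exists_nonzero [Nontrivial H] (Φ : LB H ≃ₗᵢ[ℂ] LB H) (k : ℕ) :
    ∃ j, ∀ x, qproj Φ k x j = x j := by
  by_contra! h
  have h0 : ∀ j x, qproj Φ k x j = 0 := fun j =>
    (aux_coord _ (qproj_isMProj Φ k) j).resolve_left (fun hh => by
      obtain ⟨x, hx⟩ := h j
      exact hx (hh x))
  have h1 : ∀ x, qproj Φ k x = 0 := fun x => lp.ext (funext fun j => h0 j x)
  have h2 := h1 (Φ (lp.single ∞ k (1 : H →L[ℂ] H)))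
  rw [qproj_apply, LinearIsometryEquiv.symm_apply_apply] at h2
  have h3 := (LinearIsometryEquiv.map_eq_zero_iff Φ).mp h2
  have h4 : cproj k (lp.single ∞ k (1 : H →L[ℂ] H)) k = 0 := by rw [h3]; rfl
  rw [cproj_same, lp.single_apply_self] at h4
  exact one_ne_zero h4

theorem aux_match [Nontrivial H] (Φ : LB H ≃ₗᵢ[ℂ] LB H) (m : ℕ) :
    ∃ k, ∀ x, Φ (cproj k x) = cproj m (Φ x) := by
  obtain ⟨k, hk⟩ := aux_exists_nonzero Φ.symm m
  refine ⟨k, ?_⟩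
  -- the coordinates of `Φ (cproj k x)` outside `m` vanish
  have hfix : ∀ x, qproj Φ.symm m (cproj k x) = cproj k x := by
    intro x
    refine lp.ext (funext fun j => ?_)
    rcases aux_coord _ (qproj_isMProj Φ.symm m) j with h | h
    · exact h _
    · rw [h]
      by_cases hj : j = k
      · subst hj
        rw [← hk, h]
      · rw [cproj_ne _ _ hj]
  have hfix2 : ∀ x, cproj m (Φ (cproj k x)) = Φ (cproj k x) := by
    intro x
    have := congrArg Φ (hfix x)
    simpa [qproj_apply] using this
  obtain ⟨j, hj⟩ := aux_exists_nonzero Φ k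
  have hjm : j = m := by
    by_contra hne
    have h1 := hj (lp.single ∞ j (1 : H →L[ℂ] H))
    rw [qproj_apply, ← hfix2, cproj_ne _ _ hne, lp.single_apply_self] at h1
    exact one_ne_zero h1.symm
  subst hjm
  intro x
  refine lp.ext (funext fun i => ?_)
  by_cases hi : i = j
  · subst hi
    have := hj (Φ x)
    rw [qproj_apply, LinearIsometryEquiv.symm_apply_apply] at this
    rw [this, cproj_same]
  · rw [← hfix2, cproj_ne _ _ hi, cproj_ne _ _ hi]

theorem cproj_inj [Nontrivial H] {j k : ℕ} (h : ∀ x : LB H, cproj j x = cproj k x) :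
    j = k := by
  by_contra hne
  have h1 : cproj j (lp.single ∞ j (1 : H →L[ℂ] H)) j
      = cproj k (lp.single ∞ j (1 : H →L[ℂ] H)) j := by rw [h]
  rw [cproj_same, cproj_ne _ _ hne, lp.single_apply_self] at h1
  exact one_ne_zero h1

end Helpers

/-- Let `H` be a complex separable infinite-dimensional Hilbert space and let
`Φ : ℓ∞(ℕ, B(H)) → ℓ∞(ℕ, B(H))` be a surjective linear isometry. Then there are surjective
linear isometries `ψ_n` of `B(H)` (`n ∈ ℕ`) and a bijection `φ : ℕ → ℕ` such that
`Φ((A_k)_k) = (ψ_n(A_{φ(n)}))_n`. -/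
theorem surjective_isometry_of_linfty_form
    {H : Type*} [NormedAddCommGroup H] [InnerProductSpace ℂ H] [CompleteSpace H]
    [TopologicalSpace.SeparableSpace H] [Nontrivial H]
    (hinf : ¬ FiniteDimensional ℂ H)
    (Φ : lp (fun _ : ℕ => H →L[ℂ] H) ∞ →ₗ[ℂ] lp (fun _ : ℕ => H →L[ℂ] H) ∞)
    (hsurj : Function.Surjective Φ)
    (hiso : ∀ x, ‖Φ x‖ = ‖x‖) :
    ∃ (ψ : ℕ → ((H →L[ℂ] H) →ₗ[ℂ] (H →L[ℂ] H))) (e : ℕ ≃ ℕ),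
      (∀ n, Function.Surjective (ψ n) ∧ ∀ A : H →L[ℂ] H, ‖ψ n A‖ = ‖A‖) ∧
      ∀ (x : lp (fun _ : ℕ => H →L[ℂ] H) ∞) (n : ℕ),
        (Φ x : ∀ _ : ℕ, H →L[ℂ] H) n = ψ n ((x : ∀ _ : ℕ, H →L[ℂ] H) (e n)) := by
  let Ψ : LB H ≃ₗᵢ[ℂ] LB H := LinearIsometryEquiv.ofSurjective ⟨Φ, hiso⟩ hsurj
  have hΨ : ∀ x, Ψ x = Φ x := fun x => rfl
  choose e he using aux_match Ψ
  choose d hd using aux_match Ψ.symm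
  have hed : ∀ k, e (d k) = k := by
    intro k
    apply cproj_inj (H := H)
    intro x
    apply Ψ.injective
    rw [he]
    have := congrArg Ψ (hd k (Ψ x))
    rw [LinearIsometryEquiv.apply_symm_apply, LinearIsometryEquiv.symm_apply_apply] at this
    exact this
  have hde : ∀ m, d (e m) = m := by
    intro m
    apply cproj_inj (H := H)
    intro x
    apply Ψ.symm.injective
    rw [hd]
    have := congrArg Ψ.symm (he m (Ψ.symm x))
    rw [LinearIsometryEquiv.apply_symm_apply, LinearIsometryEquiv.symm_apply_apply] at this
    exact this
  have hform : ∀ (x : LB H) (n : ℕ), Φ x n = Φ (lp.single ∞ (e n) (x (e n))) n := by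
    intro x n
    have h := he n x
    rw [hΨ, hΨ] at h
    have h2 : Φ (cproj (e n) x) n = Φ x n := by rw [h, cproj_same]
    exact h2.symm
  refine ⟨fun n =>
    { toFun := fun A => Φ (lp.single ∞ (e n) A) n
      map_add' := fun A B => by
        rw [lp.single_add, map_add]; rfl
      map_smul' := fun c A => by
        rw [lp.single_smul, map_smul]; rfl },
    ⟨e, d, hde, hed⟩, fun n => ⟨?_, ?_⟩, ?_⟩
  · intro B
    obtain ⟨x, hx⟩ := hsurj (lp.single ∞ n B)
    refine ⟨x (e n), ?_⟩
    change Φ (lp.single ∞ (e n) (x (e n))) n = B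
    rw [← hform, hx, lp.single_apply_self]
  · intro A
    change ‖Φ (lp.single ∞ (e n) A) n‖ = ‖A‖
    have h := he n (lp.single ∞ (e n) A)
    have h1 : cproj (e n) (lp.single ∞ (e n) A : LB H) = lp.single ∞ (e n) A := by
      change lp.single ∞ (e n) _ = _
      rw [lp.single_apply_self]
    rw [h1, hΨ] at h
    have h2 : ‖Φ (lp.single ∞ (e n) A)‖ = ‖Φ (lp.single ∞ (e n) A) n‖ := by
      conv_lhs => rw [h]
      exact lp.norm_single (by simp) _ _
    rw [← h2, hiso, lp.norm_single (by simp)]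
  · intro x n
    exact hform x n
end

section
/- The automorphism group of ℓ∞(ℕ, B(H)) is topologically reflexive: if Φ : ℓ∞(ℕ, B(H)) → ℓ∞(ℕ, B(H)) is a bounded complex-linear map such that for every A ∈ ℓ∞(ℕ, B(H)) the element Φ(A) belongs to the norm-closure of the set { Ψ(A) : Ψ is an algebra automorphism of ℓ∞(ℕ, B(H)) }, then Φ is itself an algebra automorphism of ℓ∞(ℕ, B(H)). -/
open scoped ENNReal

namespace TopRefl

section jordan
variable {B C : Type*} [Ring B] [Algebra ℂ B] [Ring C] [Algebra ℂ C]

theorem jordan_mul (ρ : B →ₗ[ℂ] C) (h : ∀ x, ρ (x * x) = ρ x * ρ x) (x y : B) :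
    ρ (x * y + y * x) = ρ x * ρ y + ρ y * ρ x := by
  have h1 := h (x + y)
  have e : (x + y) * (x + y) = x * x + (x * y + y * x) + y * y := by noncomm_ring
  rw [e, map_add, map_add ρ (x * x), map_add ρ x y, h, h] at h1
  have e2 : (ρ x + ρ y) * (ρ x + ρ y) = ρ x * ρ x + (ρ x * ρ y + ρ y * ρ x) + ρ y * ρ y := by
    noncomm_ring
  rw [e2] at h1
  exact add_left_cancel (add_right_cancel h1)

theorem two_cancel {x y : C} (h : x + x = y + y) : x = y := by
  have : (2 : ℂ) • x = (2 : ℂ) • y := by rw [two_smul, two_smul, h]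
  exact smul_right_injective C (two_ne_zero) this

theorem jordan_triple (ρ : B →ₗ[ℂ] C) (h : ∀ x, ρ (x * x) = ρ x * ρ x) (x y : B) :
    ρ (x * y * x) = ρ x * ρ y * ρ x := by
  have h1 := jordan_mul ρ h x (x * y + y * x)
  have h2 := jordan_mul ρ h (x * x) y
  have e : x * (x * y + y * x) + (x * y + y * x) * x
      = (x * x * y + y * (x * x)) + (x * y * x + x * y * x) := by noncomm_ring
  rw [e, map_add, h2, jordan_mul ρ h x y, h x, map_add] at h1
  apply two_cancel
  have e2 : ρ x * (ρ x * ρ y + ρ y * ρ x) + (ρ x * ρ y + ρ y * ρ x) * ρ x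
    = ρ x * ρ x * ρ y + ρ y * (ρ x * ρ x) + (ρ x * ρ y * ρ x + ρ x * ρ y * ρ x) := by
    noncomm_ring
  rw [e2] at h1
  exact add_left_cancel h1

theorem jordan_triple3 (ρ : B →ₗ[ℂ] C) (h : ∀ x, ρ (x * x) = ρ x * ρ x) (x y z : B) :
    ρ (x * y * z + z * y * x) = ρ x * ρ y * ρ z + ρ z * ρ y * ρ x := by
  have h1 := jordan_triple ρ h (x + z) y
  have e : (x + z) * y * (x + z) = x * y * x + (x * y * z + z * y * x) + z * y * z := by
    noncomm_ring
  rw [e, map_add, map_add ρ (x * y * x), map_add ρ x z, jordan_triple ρ h, jordan_triple ρ h] at h1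
  have e2 : (ρ x + ρ z) * ρ y * (ρ x + ρ z) = ρ x * ρ y * ρ x + (ρ x * ρ y * ρ z + ρ z * ρ y * ρ x)
    + ρ z * ρ y * ρ z := by noncomm_ring
  rw [e2] at h1
  exact add_left_cancel (add_right_cancel h1)

/-- idempotents with `pq + qp = 0` are orthogonal -/
theorem orth_of_anti {p q : C} (hp : p * p = p) (h : p * q + q * p = 0) :
    p * q = 0 := by
  have h1 : p * q = - (q * p) := eq_neg_of_add_eq_zero_left h
  have h2 : p * q = - (p * q * p) := by
    calc p * q = p * (p * q) := by rw [← mul_assoc, hp]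
      _ = - (p * q * p) := by
        nth_rewrite 1 [h1]; rw [mul_neg, mul_assoc]
  have h3 : p * q * p = - (p * q * p) := by
    calc p * q * p = -(p * q * p) * p := by rw [← h2]
      _ = - (p * q * (p * p)) := by noncomm_ring
      _ = _ := by rw [hp]
  have h4 : p * q * p = 0 := by
    apply two_cancel
    nth_rewrite 1 [h3]; simp
  rw [h2, h4, neg_zero]

end jordan

section peirce
variable {B : Type*} [Ring B] [Algebra ℂ B]
variable {H : Type*} [NormedAddCommGroup H] [InnerProductSpace ℂ H]

/-- Peirce alternative for a single element. -/
theorem peirce_alt (ρ : B →ₗ[ℂ] (H →L[ℂ] H)) (h : ∀ x, ρ (x * x) = ρ x * ρ x) (P : B)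
    (f : H) (hf : ρ P f = f) (hQ : ∀ v, ∃ c : ℂ, ρ P v = c • f) (X : B)
    (hX0 : X * X = 0) (hX : X * P + P * X = X) :
    ρ X f = 0 ∨ ρ P * ρ X = 0 := by
  have h1 : ρ X = ρ X * ρ P + ρ P * ρ X := by
    rw [← jordan_mul ρ h, hX]
  have h2 : ρ X * ρ X = 0 := by rw [← h, hX0, map_zero]
  have hPP : ρ P * ρ P = ρ P := by
    ext v
    obtain ⟨c, hc⟩ := hQ v
    simp [hc, hf]
  have h3 : ρ P * ρ X * ρ P = 0 := by
    have : ρ P * ρ X = ρ P * ρ X * ρ P + ρ P * ρ X := by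
      conv_lhs => rw [h1]
      rw [mul_add, ← mul_assoc, ← mul_assoc, hPP]
    simpa using this
  have h4 : ρ X * ρ P * ρ X = 0 := by
    calc ρ X * ρ P * ρ X = (ρ X - ρ P * ρ X) * ρ X := by
          congr 1; rw [eq_sub_iff_add_eq, ← h1]
      _ = 0 := by rw [sub_mul, mul_assoc, h2]; simp
  by_cases hfz : ρ X f = 0
  · exact Or.inl hfz
  · right
    ext v
    obtain ⟨c, hc⟩ := hQ (ρ X v)
    have := congrArg (fun T : H →L[ℂ] H => T v) h4
    simp [hc] at this
    rcases this with hc0 | h0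
    · simp [hc, hc0]
    · exact absurd h0 hfz

/-- uniform alternative on a family closed under addition. -/
theorem peirce_unif (ρ : B →ₗ[ℂ] (H →L[ℂ] H)) (P : B) (f : H) (S : B → Prop)
    (hadd : ∀ X Y, S X → S Y → S (X + Y))
    (halt : ∀ X, S X → ρ X f = 0 ∨ ρ P * ρ X = 0) :
    (∀ X, S X → ρ X f = 0) ∨ (∀ X, S X → ρ P * ρ X = 0) := by
  by_contra hcon
  push Not at hcon
  obtain ⟨⟨X, hX, hX1⟩, ⟨Y, hY, hY1⟩⟩ := hcon
  have hX2 := (halt X hX).resolve_left hX1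
  have hY2 := (halt Y hY).resolve_right hY1
  rcases halt _ (hadd X Y hX hY) with h | h
  · rw [map_add] at h; simp [hY2] at h; exact hX1 h
  · rw [map_add, mul_add, hX2, zero_add] at h; exact hY1 h

/-- dichotomy -/
theorem peirce_dich (ρ : B →ₗ[ℂ] (H →L[ℂ] H)) (h : ∀ x, ρ (x * x) = ρ x * ρ x) (P : B)
    (f : H) (hf0 : f ≠ 0) (hf : ρ P f = f) (hQ : ∀ v, ∃ c : ℂ, ρ P v = c • f)
    (X0 Y0 : B) (hX1 : X0 * P = X0) (hX2 : P * X0 = 0) (hY1 : P * Y0 = Y0) (hY2 : Y0 * P = 0)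
    (hYX : Y0 * X0 = P) :
    (∀ X, X * P = X → P * X = 0 → ρ P * ρ X = 0) ∨
    (∀ Y, P * Y = Y → Y * P = 0 → ρ P * ρ Y = 0) := by
  have A1 := peirce_unif ρ P f (fun X => X * P = X ∧ P * X = 0)
    (by rintro X Y ⟨a, b⟩ ⟨c, d⟩; rw [add_mul, mul_add, a, b, c, d]; simp)
    (by
      rintro X ⟨a, b⟩
      apply peirce_alt ρ h P f hf hQ X _ (by rw [a, b, add_zero])
      rw [← a, mul_assoc, ← mul_assoc P, b]; simp)
  have A2 := peirce_unif ρ P f (fun X => P * X = X ∧ X * P = 0)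
    (by rintro X Y ⟨a, b⟩ ⟨c, d⟩; rw [add_mul, mul_add, a, b, c, d]; simp)
    (by
      rintro X ⟨a, b⟩
      apply peirce_alt ρ h P f hf hQ X _ (by rw [a, b, zero_add])
      rw [← a, mul_assoc, ← mul_assoc X, b]; simp)
  rcases A1 with A1 | A1
  · rcases A2 with A2 | A2
    · exfalso
      have e1 := A1 X0 ⟨hX1, hX2⟩
      have e2 := A2 Y0 ⟨hY1, hY2⟩
      have e3 := congrArg (fun T : H →L[ℂ] H => T f) (jordan_mul ρ h X0 Y0)
      simp [e1, e2, hYX, hf] at e3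
      have e4 := jordan_mul ρ h (X0 * Y0) P
      have e5 : X0 * Y0 * P + P * (X0 * Y0) = 0 := by
        rw [mul_assoc, hY2, ← mul_assoc P, hX2]; simp
      rw [e5, map_zero] at e4
      have id1 : ρ (X0 * Y0) * ρ (X0 * Y0) = ρ (X0 * Y0) := by
        rw [← h]; congr 1
        calc X0 * Y0 * (X0 * Y0) = X0 * (Y0 * X0) * Y0 := by noncomm_ring
          _ = _ := by rw [hYX, hX1]
      have e6 := orth_of_anti id1 e4.symm
      have e7 := congrArg (fun T : H →L[ℂ] H => T f) e6
      simp [hf] at e7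
      rw [e7, zero_add] at e3
      exact hf0 e3
    · right; exact fun Y a b => A2 Y ⟨a, b⟩
  · left; exact fun Y a b => A1 Y ⟨a, b⟩

/-- the intertwining identity in the homomorphic case -/
theorem intertwine (ρ : B →ₗ[ℂ] (H →L[ℂ] H)) (h : ∀ x, ρ (x * x) = ρ x * ρ x) (P : B)
    (hP : P * P = P) (hmin : ∀ Z, ∃ c : ℂ, P * Z * P = c • P)
    (f : H) (hf : ρ P f = f)
    (X0 Y0 : B) (hX1 : X0 * P = X0) (hX2 : P * X0 = 0) (hY1 : P * Y0 = Y0) (hY2 : Y0 * P = 0)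
    (hYX : Y0 * X0 = P)
    (hc : ∀ X, X * P = X → P * X = 0 → ρ P * ρ X = 0) (A X : B) :
    ρ A (ρ (X * P) f) = ρ (A * X * P) f := by
  have key : ∀ A U, U * P = U → P * U = 0 → ρ A (ρ U f) = ρ (A * U) f := by
    intro A U h1 h2
    have e := congrArg (fun T : H →L[ℂ] H => T f) (jordan_triple3 ρ h A U P)
    simp only [hc U h1 h2, h2, mul_assoc, h1, zero_mul, add_zero] at e
    simp [hf] at e
    exact e.symm
  have hfe : ρ Y0 (ρ X0 f) = f := by rw [key _ _ hX1 hX2, hYX, hf]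
  have hY00 : Y0 * Y0 = 0 := by
    rw [← hY1, mul_assoc, ← mul_assoc Y0, hY2]; simp
  have hYf : ρ Y0 f = 0 := by
    rw [← hfe]
    have := congrArg (fun T : H →L[ℂ] H => T (ρ X0 f)) (h Y0)
    simp [hY00] at this
    exact this.symm
  have keyP : ∀ A, ρ (A * P) f = ρ A f := by
    intro A
    have e := congrArg (fun T : H →L[ℂ] H => T (ρ X0 f)) (jordan_mul ρ h A Y0)
    simp only [map_add, add_apply, mul_apply_eq_comp] at e
    rw [key _ _ hX1 hX2, key _ _ hX1 hX2, hfe, key _ _ hX1 hX2, mul_assoc, hYX] at e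
    have e2 : ρ Y0 (ρ (A * X0) f) = ρ (Y0 * A * X0) f := by
      obtain ⟨c, hcc⟩ := hmin (A * X0)
      have d : A * X0 = (A * X0 - P * (A * X0)) + P * (A * X0) * P := by
        rw [mul_assoc P, mul_assoc A, hX1]; simp
      have d1 : ρ Y0 (ρ (P * (A * X0) * P) f) = 0 := by
        rw [hcc]; simp [hf, hYf]
      rw [d, map_add, add_apply, map_add, d1, add_zero, key]
      · congr 2
        rw [mul_sub, ← mul_assoc Y0 P, hY2]; simp [mul_assoc]
      · rw [sub_mul, mul_assoc A, mul_assoc P, mul_assoc A, hX1]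
      · rw [mul_sub, ← mul_assoc P P, hP, sub_self]
    rw [e2] at e
    exact add_right_cancel e
  obtain ⟨c, hcc⟩ := hmin X
  have d : X * P = (X * P - P * X * P) + P * X * P := by simp
  have d2 : A * X * P = A * (X * P - P * X * P) + c • (A * P) := by
    rw [← mul_smul_comm, ← hcc, ← mul_add, ← d, mul_assoc]
  rw [d2, d, map_add, add_apply, map_add, key, hcc, map_smul, map_add,
    map_smul]
  · simp [hf, keyP]
  · rw [sub_mul, mul_assoc, hP, mul_assoc (P * X), hP]
  · rw [mul_sub, mul_assoc P X, ← mul_assoc P P, hP, sub_self]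

/-- abstract multiplicativity -/
theorem mult_of_intertwine (ρ : B →ₗ[ℂ] (H →L[ℂ] H)) (P : B)
    (f : H) (hf0 : f ≠ 0) (hf : ρ P f = f)
    (hitw : ∀ A X : B, ρ A (ρ (X * P) f) = ρ (A * X * P) f)
    (S : Set B)
    (hS : ∀ p ∈ S, ρ p = 0 ∨ (∃ X Y : B, X * P = X ∧ p * X = X ∧ Y * X = P))
    (hS1 : ∀ p ∈ S, ∀ v, v ≠ 0 → ρ p v = v → ∀ w, ∃ c : ℂ, ρ p w = c • v)
    (hK : ∀ M : Submodule ℂ H, (∀ A, ∀ v ∈ M, ρ A v ∈ M) → (∀ p ∈ S, ∀ v, ρ p v ∈ M) →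
      Dense (M : Set H)) :
    Dense (Set.range fun X : B => ρ (X * P) f) ∧ ∀ A A', ρ (A * A') = ρ A * ρ A' := by
  have hM : Dense (Set.range fun X : B => ρ (X * P) f) := by
    let L : B →ₗ[ℂ] H :=
      { toFun := fun X => ρ (X * P) f
        map_add' := by intro x y; simp [add_mul]
        map_smul' := by intro c x; simp }
    have := hK (LinearMap.range L) ?_ ?_
    · exact this
    · rintro A v ⟨X, rfl⟩
      exact ⟨A * X, (hitw A X).symm⟩
    · intro p hp v
      rcases hS p hp with h0 | ⟨X, Y, h1, h2, h3⟩
      · rw [h0]; simp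
      · have e1 : ρ p (ρ X f) = ρ X f := by
          have := hitw p X; rwa [h1, mul_assoc, h1, h2] at this
        have e2 : ρ Y (ρ X f) = f := by
          have := hitw Y X; rwa [h1, mul_assoc, h1, h3, hf] at this
        have e3 : ρ X f ≠ 0 := by
          intro h0; rw [h0, map_zero] at e2; exact hf0 e2.symm
        obtain ⟨c, hc⟩ := hS1 p hp _ e3 e1 v
        refine ⟨c • X, ?_⟩
        simp [L, h1, hc]
  refine ⟨hM, fun A A' => ?_⟩
  apply ContinuousLinearMap.coe_inj.1
  apply LinearMap.ext
  intro v
  have : (fun v => ρ (A * A') v) = fun v => (ρ A * ρ A') v := by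
    apply Continuous.ext_on hM (ContinuousLinearMap.continuous _) (ContinuousLinearMap.continuous _)
    rintro _ ⟨X, rfl⟩
    simp only [mul_apply_eq_comp]
    rw [hitw, hitw, hitw, mul_assoc, mul_assoc, mul_assoc, mul_assoc]
  exact congrFun this v

end peirce
end TopRefl

namespace TopRefl

section spectral
variable {H : Type*} [NormedAddCommGroup H] [InnerProductSpace ℂ H] [CompleteSpace H]

set_option maxHeartbeats 1000000 in
theorem half_proj (A : H →L[ℂ] H) (h0 : 0 ≤ A) (h1 : A ≤ 1) :
    ∃ P : H →L[ℂ] H, P * P = P ∧ IsSelfAdjoint P ∧ 0 ≤ (2 : ℂ) • A - P ∧ (2 : ℂ) • A - P ≤ 1 ∧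
      ∀ B : H →L[ℂ] H, IsSelfAdjoint B → Commute A B → Commute P B := by
  have hA : IsSelfAdjoint A := IsSelfAdjoint.of_nonneg h0
  set D : H →L[ℂ] H := A + A - 1 with hD
  have hDsa : IsSelfAdjoint D := (hA.add hA).sub (IsSelfAdjoint.one _)
  have hpn : D⁺ - D⁻ = D := CFC.posPart_sub_negPart D hDsa
  have hmul : D⁺ * D⁻ = 0 := CFC.posPart_mul_negPart D
  have hpos : 0 ≤ D⁺ := CFC.posPart_nonneg D
  have hneg : 0 ≤ D⁻ := CFC.negPart_nonneg D
  set K : Submodule ℂ H := (D⁺ : H →L[ℂ] H).ker with hK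
  have hKc : IsClosed (K : Set H) := ContinuousLinearMap.isClosed_ker _
  have : CompleteSpace K := hKc.completeSpace_coe
  set R := K.starProjection with hR
  have hRR : R * R = R := K.isIdempotentElem_starProjection
  have hRsa : IsSelfAdjoint R := isSelfAdjoint_starProjection K
  have hmem : ∀ v, R v ∈ K := fun v => K.starProjection_apply_mem v
  have hfix : ∀ v ∈ K, R v = v := fun v hv => Submodule.starProjection_eq_self_iff.2 hv
  have e1 : D⁺ * R = 0 := by
    ext v; exact (hmem v)
  have e1' : R * D⁺ = 0 := by
    have := congrArg star e1
    rwa [star_mul, hRsa.star_eq, (IsSelfAdjoint.of_nonneg hpos).star_eq, star_zero] at this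
  have e2 : R * D⁻ = D⁻ := by
    ext v
    apply hfix
    show (D⁺ * D⁻) v = 0
    rw [hmul]; rfl
  have e2' : D⁻ * R = D⁻ := by
    have := congrArg star e2
    rwa [star_mul, hRsa.star_eq, (IsSelfAdjoint.of_nonneg hneg).star_eq] at this
  have hPsa : IsSelfAdjoint (1 - R) := (IsSelfAdjoint.one _).sub hRsa
  have t : (2 : ℂ) • A = D + 1 := by rw [two_smul, hD]; abel
  refine ⟨1 - R, ?_, hPsa, ?_, ?_, ?_⟩
  · rw [mul_sub, sub_mul, sub_mul, hRR]; simp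
  · have : (2 : ℂ) • A - (1 - R) = D⁺ + R * (A + A) * star R := by
      have : A + A = D⁺ - D⁻ + 1 := by rw [hpn, hD]; abel
      rw [t, this, hRsa.star_eq, mul_add, add_mul, mul_sub, sub_mul, e1', e2, e2', mul_one, hRR]
      nth_rewrite 1 [← hpn]
      simp only [zero_mul]
      abel
    rw [this]
    exact add_nonneg hpos (star_right_conjugate_nonneg (add_nonneg h0 h0) _)
  · rw [← sub_nonneg]
    have : 1 - ((2 : ℂ) • A - (1 - R)) = D⁻ + (1 - R) * ((1 - A) + (1 - A)) * star (1 - R) := by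
      have : (1 - A) + (1 - A) = 1 - (D⁺ - D⁻) := by rw [hpn, hD]; abel
      rw [t, this, hPsa.star_eq]
      have a1 : (1 - R) * D⁺ = D⁺ := by rw [sub_mul, e1']; simp
      have a2 : (1 - R) * D⁻ = 0 := by rw [sub_mul, e2]; simp
      have a3 : D⁺ * (1 - R) = D⁺ := by rw [mul_sub, e1]; simp
      have a4 : (1 - R) * (1 - R) = 1 - R := by rw [mul_sub, sub_mul, sub_mul, hRR]; simp
      rw [mul_sub (1 - R) 1 (D⁺ - D⁻), mul_sub (1 - R) (D⁺) (D⁻), a1, a2, sub_zero, mul_one,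
        sub_mul (1 - R) (D⁺) (1 - R), a3, a4]
      nth_rewrite 1 [← hpn]
      abel
    rw [this]
    have h1' : 0 ≤ 1 - A := sub_nonneg.2 h1
    exact add_nonneg hneg (star_right_conjugate_nonneg (add_nonneg h1' h1') _)
  · intro B hB hAB
    have hDB : Commute D B := (hAB.add_left hAB).sub_left (Commute.one_left _)
    have hDp : Commute (D⁺) B := by
      rw [CFC.posPart_def]
      exact hDB.cfcₙ_real _
    have b1 : R * (B * R) = B * R := by
      ext v
      apply hfix
      show (D⁺ : H →L[ℂ] H) (B (R v)) = 0
      have c1 : (D⁺ : H →L[ℂ] H) (B (R v)) = B ((D⁺ : H →L[ℂ] H) (R v)) :=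
        congrArg (fun T : H →L[ℂ] H => T (R v)) hDp.eq
      rw [c1]
      have c2 : (D⁺ : H →L[ℂ] H) (R v) = 0 := hmem v
      rw [c2, map_zero]
    have b2 := congrArg star b1
    rw [star_mul, star_mul, hRsa.star_eq, hB.star_eq, mul_assoc, b1] at b2
    have : Commute R B := b2.symm
    exact (Commute.one_left _).sub_left this

theorem exists_proj_seq : ∃ p : (H →L[ℂ] H) → ℕ → (H →L[ℂ] H), ∀ A, 0 ≤ A → A ≤ 1 →
    (∀ k, p A k * p A k = p A k) ∧ (∀ k, ‖p A k‖ ≤ 1) ∧ (∀ j k, Commute (p A j) (p A k)) ∧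
    ∀ K, ‖A - ∑ k ∈ Finset.range K, ((2 : ℂ)⁻¹ ^ (k + 1)) • p A k‖ ≤ (2 : ℝ)⁻¹ ^ K := by
  choose! F hF1 hF2 hF3 hF4 hF5 using half_proj (H := H)
  let a : (H →L[ℂ] H) → ℕ → (H →L[ℂ] H) := fun A n =>
    Nat.rec A (fun _ a => (2 : ℂ) • a - F a) n
  have a0 : ∀ A, a A 0 = A := fun A => rfl
  have as : ∀ A n, a A (n + 1) = (2 : ℂ) • a A n - F (a A n) := fun A n => rfl
  refine ⟨fun A k => F (a A k), fun A h0 h1 => ?_⟩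
  have hb : ∀ n, 0 ≤ a A n ∧ a A n ≤ 1 := by
    intro n
    induction n with
    | zero => exact ⟨h0, h1⟩
    | succ n ih => rw [as]; exact ⟨hF3 _ ih.1 ih.2, hF4 _ ih.1 ih.2⟩
  have hnorm1 : ∀ B : H →L[ℂ] H, 0 ≤ B → B ≤ 1 → ‖B‖ ≤ 1 := fun B h h' =>
    (CStarAlgebra.norm_le_one_iff_of_nonneg B h).2 h'
  have hcom : ∀ k j, k < j → Commute (a A j) (F (a A k)) := by
    intro k j hkj
    induction j, hkj using Nat.le_induction with
    | base =>
      rw [as]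
      have := hF5 _ (hb k).1 (hb k).2 (a A k) (IsSelfAdjoint.of_nonneg (hb k).1) (Commute.refl _)
      exact (this.symm.smul_left _).sub_left (Commute.refl _)
    | succ j hj ih =>
      rw [as]
      have := hF5 _ (hb j).1 (hb j).2 _ (hF2 _ (hb k).1 (hb k).2) ih
      exact (ih.smul_left _).sub_left this
  have hlt : ∀ k j, k < j → Commute (F (a A j)) (F (a A k)) := fun k j hkj =>
    hF5 _ (hb j).1 (hb j).2 _ (hF2 _ (hb k).1 (hb k).2) (hcom k j hkj)
  refine ⟨fun k => hF1 _ (hb k).1 (hb k).2, fun k => ?_, fun j k => ?_, fun K => ?_⟩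
  · have hi := hF1 _ (hb k).1 (hb k).2
    have hs := hF2 _ (hb k).1 (hb k).2
    have : IsStarProjection (F (a A k)) := ⟨hi, hs⟩
    exact this.norm_le
  · rcases lt_trichotomy j k with h | h | h
    · exact (hlt _ _ h).symm
    · rw [h]
    · exact hlt _ _ h
  · have : A - ∑ k ∈ Finset.range K, ((2 : ℂ)⁻¹ ^ (k + 1)) • F (a A k)
        = ((2 : ℂ)⁻¹ ^ K) • a A K := by
      induction K with
      | zero => simp [a0]
      | succ K ih =>
        rw [Finset.sum_range_succ, ← sub_sub, ih, as, smul_sub, smul_smul, pow_succ]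
        simp
    rw [this, norm_smul, norm_pow, norm_inv]
    have h2 : ‖(2 : ℂ)‖ = 2 := by simp
    rw [h2]
    exact mul_le_of_le_one_right (by positivity) (hnorm1 _ (hb K).1 (hb K).2)

end spectral
end TopRefl

namespace TopRefl
set_option linter.unusedSectionVars false

section J2
variable {B C : Type*} [Ring B] [Algebra ℂ B] [Ring C] [Algebra ℂ C]

/-- Jordan compatibility of a pair. -/
def J2 (Φ : B →ₗ[ℂ] C) (x y : B) : Prop := Φ (x * y + y * x) = Φ x * Φ y + Φ y * Φ x

theorem J2.symm {Φ : B →ₗ[ℂ] C} {x y : B} (h : J2 Φ x y) : J2 Φ y x := by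
  unfold J2 at *; rw [add_comm, h, add_comm]

theorem J2.add_left {Φ : B →ₗ[ℂ] C} {x x' y : B} (h : J2 Φ x y) (h' : J2 Φ x' y) :
    J2 Φ (x + x') y := by
  unfold J2 at *
  have : (x + x') * y + y * (x + x') = (x * y + y * x) + (x' * y + y * x') := by noncomm_ring
  rw [this, map_add, h, h', map_add]; noncomm_ring

theorem J2.smul_left {Φ : B →ₗ[ℂ] C} {x y : B} (c : ℂ) (h : J2 Φ x y) : J2 Φ (c • x) y := by
  unfold J2 at *
  rw [smul_mul_assoc, mul_smul_comm, ← smul_add, map_smul, h, map_smul, smul_mul_assoc,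
    mul_smul_comm, smul_add]

theorem J2.zero_left {Φ : B →ₗ[ℂ] C} {y : B} : J2 Φ 0 y := by simp [J2]

theorem J2.sum_left {Φ : B →ₗ[ℂ] C} {y : B} (s : Finset ℕ) (f : ℕ → B)
    (h : ∀ k, J2 Φ (f k) y) : J2 Φ (∑ k ∈ s, f k) y := by
  induction s using Finset.induction_on with
  | empty => simpa using J2.zero_left
  | insert a s ha ih => rw [Finset.sum_insert ha]; exact (h a).add_left ih

theorem J2.polar {Φ : B →ₗ[ℂ] C} {x y : B} (h : J2 Φ (x + y) (x + y)) (hx : J2 Φ x x)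
    (hy : J2 Φ y y) : J2 Φ x y := by
  unfold J2 at *
  apply two_cancel
  have e : (x + y) * (x + y) + (x + y) * (x + y) = (x * x + x * x) + (y * y + y * y)
    + ((x * y + y * x) + (x * y + y * x)) := by noncomm_ring
  rw [e, map_add, map_add Φ (x * x + x * x), hx, hy, map_add Φ (x * y + y * x), map_add Φ x y] at h
  have e2 : (Φ x + Φ y) * (Φ x + Φ y) + (Φ x + Φ y) * (Φ x + Φ y) =
     Φ x * Φ x + Φ x * Φ x + (Φ y * Φ y + Φ y * Φ y) +
     ((Φ x * Φ y + Φ y * Φ x) + (Φ x * Φ y + Φ y * Φ x)) := by noncomm_ring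
  rw [e2] at h
  exact add_left_cancel h

theorem J2_of_commute_idem (Φ : B →ₗ[ℂ] C) (hΦ : ∀ p, p * p = p → Φ p * Φ p = Φ p)
    {p q : B} (hp : p * p = p) (hq : q * q = q) (hpq : Commute p q) : J2 Φ p q := by
  have horth : ∀ e g : B, e * e = e → g * g = g → e * g = 0 → g * e = 0 →
      Φ e * Φ g + Φ g * Φ e = 0 := by
    intro e g he hg h1 h2
    have h3 := hΦ (e + g) (by rw [add_mul, mul_add, mul_add, he, hg, h1, h2]; simp)
    rw [map_add, add_mul, mul_add, mul_add, hΦ e he, hΦ g hg] at h3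
    have : Φ e + Φ g + (Φ e * Φ g + Φ g * Φ e) = Φ e + Φ g + 0 := by
      rw [add_zero]
      calc _ = Φ e + Φ e * Φ g + (Φ g * Φ e + Φ g) := by abel
        _ = _ := h3
    exact add_left_cancel this
  have hqp : q * p = p * q := hpq.eq.symm
  set a := p * q with ha
  have pa : p * a = a := by rw [ha, ← mul_assoc, hp]
  have ap : a * p = a := by rw [ha, mul_assoc, hqp, ha, ← mul_assoc, hp]
  have qa : q * a = a := by rw [ha, ← mul_assoc, hqp, ha, mul_assoc, hq]
  have aq : a * q = a := by rw [ha, mul_assoc, hq]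
  have aa : a * a = a := by nth_rewrite 1 [ha]; rw [mul_assoc, qa, pa]
  have hbb : (p - a) * (p - a) = p - a := by rw [sub_mul, mul_sub, mul_sub, hp, pa, ap, aa]; simp
  have hcc : (q - a) * (q - a) = q - a := by rw [sub_mul, mul_sub, mul_sub, hq, qa, aq, aa]; simp
  have o1 := horth a (p - a) aa hbb (by rw [mul_sub, ap, aa, sub_self])
    (by rw [sub_mul, pa, aa, sub_self])
  have o2 := horth a (q - a) aa hcc (by rw [mul_sub, aq, aa, sub_self])
    (by rw [sub_mul, qa, aa, sub_self])
  have o3 := horth (p - a) (q - a) hbb hcc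
    (by rw [sub_mul, mul_sub, mul_sub, pa, aq, aa, ← ha]; simp)
    (by rw [sub_mul, mul_sub, mul_sub, qa, ap, aa, hqp]; simp)
  have oa := hΦ a aa
  unfold J2
  rw [hqp, map_add]
  have e1 : Φ p = Φ a + Φ (p - a) := by rw [← map_add]; simp
  have e2 : Φ q = Φ a + Φ (q - a) := by rw [← map_add]; simp
  rw [e1, e2]
  generalize Φ (p - a) = b at *
  generalize Φ (q - a) = c at *
  generalize Φ a = α at *
  have : (α + b) * (α + c) + (α + c) * (α + b) = (α * α + α * α) + (α * b + b * α) + (α * c + c * α)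
    + (b * c + c * b) := by noncomm_ring
  rw [this, o1, o2, o3, oa]; simp

end J2

section main
variable {H : Type*} [NormedAddCommGroup H] [InnerProductSpace ℂ H] [CompleteSpace H] [Nontrivial H]

/-- bounded sequences of operators -/
noncomputable abbrev AA (H : Type*) [NormedAddCommGroup H] [InnerProductSpace ℂ H] :=
  lp (fun _ : ℕ => H →L[ℂ] H) ∞

/-- build an element of `ℓ∞` from a bounded sequence -/
noncomputable def mkA {H : Type*} [NormedAddCommGroup H] [InnerProductSpace ℂ H]
    (f : ℕ → (H →L[ℂ] H)) (C : ℝ) (h : ∀ n, ‖f n‖ ≤ C) : AA H :=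
  ⟨f, memℓp_infty ⟨C, by rintro _ ⟨n, rfl⟩; exact h n⟩⟩

@[simp] theorem mkA_apply (f : ℕ → (H →L[ℂ] H)) (C : ℝ) (h : ∀ n, ‖f n‖ ≤ C) (n : ℕ) :
    mkA f C h n = f n := rfl

@[simp] theorem mul_ap (x y : AA H) (n : ℕ) : (x * y) n = x n * y n := rfl
@[simp] theorem one_ap (n : ℕ) : (1 : AA H) n = 1 := rfl
@[simp] theorem add_ap (x y : AA H) (n : ℕ) : (x + y) n = x n + y n := rfl
@[simp] theorem sub_ap (x y : AA H) (n : ℕ) : (x - y) n = x n - y n := rfl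
@[simp] theorem smul_ap (c : ℂ) (x : AA H) (n : ℕ) : (c • x) n = c • x n := rfl
@[simp] theorem star_ap (x : AA H) (n : ℕ) : (star x) n = star (x n) := rfl
@[simp] theorem zero_ap (n : ℕ) : (0 : AA H) n = 0 := rfl

theorem sum_ap {ι : Type*} (s : Finset ι) (f : ι → AA H) (n : ℕ) :
    (∑ k ∈ s, f k) n = ∑ k ∈ s, f k n := by
  rw [lp.coeFn_sum, Finset.sum_apply]

theorem ext_ap {x y : AA H} (h : ∀ n, x n = y n) : x = y := lp.ext (funext h)

theorem norm_ap_le (x : AA H) (n : ℕ) : ‖x n‖ ≤ ‖x‖ := lp.norm_apply_le_norm (by simp) x n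

theorem norm_le_of {x : AA H} {C : ℝ} (hC : 0 ≤ C) (h : ∀ n, ‖x n‖ ≤ C) : ‖x‖ ≤ C :=
  lp.norm_le_of_forall_le hC h

theorem J2_pos (Φ : AA H →L[ℂ] AA H) (hΦ : ∀ p, p * p = p → Φ p * Φ p = Φ p)
    (x : AA H) (h0 : ∀ n, 0 ≤ x n) (h1 : ∀ n, x n ≤ 1) : J2 Φ.toLinearMap x x := by
  obtain ⟨p, hp⟩ := exists_proj_seq (H := H)
  choose hp1 hp2 hp3 hp4 using fun n => hp (x n) (h0 n) (h1 n)
  let P : ℕ → AA H := fun k => mkA (fun n => p (x n) k) 1 (fun n => hp2 n k)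
  have hPi : ∀ k, P k * P k = P k := fun k => ext_ap fun n => hp1 n k
  have hPc : ∀ j k, Commute (P j) (P k) := fun j k => ext_ap fun n => hp3 n j k
  let s : ℕ → AA H := fun K => ∑ k ∈ Finset.range K, ((2 : ℂ)⁻¹ ^ (k + 1)) • P k
  have hs : Filter.Tendsto s Filter.atTop (nhds x) := by
    rw [tendsto_iff_norm_sub_tendsto_zero]
    refine squeeze_zero (fun _ => norm_nonneg _) (fun K => ?_)
      (tendsto_pow_atTop_nhds_zero_of_lt_one (r := (2 : ℝ)⁻¹) (by norm_num) (by norm_num))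
    rw [norm_sub_rev]
    refine norm_le_of (by positivity) fun n => ?_
    have := hp4 n K
    have e : (x - s K) n = x n - ∑ k ∈ Finset.range K, ((2 : ℂ)⁻¹ ^ (k + 1)) • p (x n) k := by
      rw [sub_ap, sum_ap]; rfl
    rw [e]; exact this
  have hJ : ∀ K, J2 Φ.toLinearMap (s K) (s K) := by
    intro K
    refine J2.sum_left _ _ fun k => J2.smul_left _ (J2.symm (J2.sum_left _ _ fun j =>
      J2.smul_left _ ?_))
    exact J2_of_commute_idem _ hΦ (hPi j) (hPi k) (hPc j k)
  have c1 : Filter.Tendsto (fun K => Φ (s K * s K + s K * s K)) Filter.atTop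
    (nhds (Φ (x * x + x * x))) := (Φ.continuous.tendsto _).comp ((hs.mul hs).add (hs.mul hs))
  have hs2 := (Φ.continuous.tendsto x).comp hs
  have c2 : Filter.Tendsto (fun K => Φ (s K) * Φ (s K) + Φ (s K) * Φ (s K)) Filter.atTop
    (nhds (Φ x * Φ x + Φ x * Φ x)) := (hs2.mul hs2).add (hs2.mul hs2)
  have : (fun K => Φ (s K * s K + s K * s K)) = fun K => Φ (s K) * Φ (s K) + Φ (s K) * Φ (s K) :=
    funext hJ
  rw [this] at c1
  exact tendsto_nhds_unique c1 c2

theorem J2_sa (Φ : AA H →L[ℂ] AA H) (hΦ : ∀ p, p * p = p → Φ p * Φ p = Φ p) (h1 : Φ 1 = 1)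
    (x : AA H) (hx : star x = x) : J2 Φ.toLinearMap x x := by
  have hone : ∀ y, J2 Φ.toLinearMap 1 y := by intro y; simp [J2, h1]
  have hsmall : ∀ y : AA H, star y = y → ‖y‖ ≤ 1 → J2 Φ.toLinearMap y y := by
    intro y hy hn
    have hysa : ∀ n, IsSelfAdjoint (y n) := fun n => by
      have := congrArg (fun z : AA H => z n) hy
      exact this
    have hle : ∀ n, y n ≤ 1 := fun n => by
      refine (hysa n).le_algebraMap_norm_self.trans ?_
      have : ‖y n‖ ≤ 1 := (norm_ap_le y n).trans hn
      have := algebraMap_mono (H →L[ℂ] H) this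
      simpa using this
    have hge : ∀ n, -1 ≤ y n := fun n => by
      refine le_trans ?_ (hysa n).neg_algebraMap_norm_le_self
      have : ‖y n‖ ≤ 1 := (norm_ap_le y n).trans hn
      have := neg_le_neg (algebraMap_mono (H →L[ℂ] H) this)
      simpa using this
    have hhalf : ∀ z : H →L[ℂ] H, (2⁻¹ : ℂ) • z = (2⁻¹ : ℝ) • z := by
      intro z
      have h2 : (2⁻¹ : ℂ) = ((2⁻¹ : ℝ) : ℂ) := by norm_num
      rw [h2]; exact Complex.coe_smul _ _
    have hu := J2_pos Φ hΦ ((2⁻¹ : ℂ) • (1 + y)) (fun n => by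
      rw [smul_ap, hhalf]
      refine smul_nonneg (by norm_num) ?_
      have := hge n
      rw [add_ap, one_ap, ← neg_le_iff_add_nonneg']; exact this) (fun n => by
      rw [smul_ap, hhalf]
      have : (1 + y) n ≤ (2 : ℝ) • (1 : H →L[ℂ] H) := by
        rw [two_smul]; exact add_le_add (le_refl _) (hle n)
      calc _ ≤ (2⁻¹ : ℝ) • (2 : ℝ) • (1 : H →L[ℂ] H) :=
            smul_le_smul_of_nonneg_left this (by norm_num)
        _ = 1 := by rw [smul_smul]; norm_num)
    have h2 := J2.smul_left 2 (J2.symm (J2.smul_left 2 hu))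
    rw [smul_smul, mul_inv_cancel₀ two_ne_zero, one_smul] at h2
    have h3 : J2 Φ.toLinearMap y (1 + y) := by
      have := h2.add_left (J2.smul_left (-1) (hone (1 + y)))
      have e : 1 + y + (-1 : ℂ) • 1 = y := by simp
      rwa [e] at this
    have := (h3.symm).add_left (J2.smul_left (-1) (hone y))
    have e : 1 + y + (-1 : ℂ) • 1 = y := by simp
    rwa [e] at this
  by_cases hx0 : x = 0
  · rw [hx0]; exact J2.zero_left
  have hn : (‖x‖ : ℂ) ≠ 0 := by simpa using hx0
  have := hsmall ((‖x‖ : ℂ)⁻¹ • x) (by rw [star_smul, hx]; simp) (by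
    rw [norm_smul]; simp [hx0])
  have h2 := J2.smul_left (‖x‖ : ℂ) (J2.symm (J2.smul_left (‖x‖ : ℂ) this))
  rwa [smul_smul, mul_inv_cancel₀ hn, one_smul] at h2

theorem jordan_all (Φ : AA H →L[ℂ] AA H) (hΦ : ∀ p, p * p = p → Φ p * Φ p = Φ p) (h1 : Φ 1 = 1)
    (x : AA H) : Φ (x * x) = Φ x * Φ x := by
  have hsa : ∀ y z : AA H, star y = y → star z = z → J2 Φ.toLinearMap y z := by
    intro y z hy hz
    exact J2.polar (J2_sa Φ hΦ h1 _ (by rw [star_add, hy, hz])) (J2_sa Φ hΦ h1 _ hy)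
      (J2_sa Φ hΦ h1 _ hz)
  set y : AA H := x + star x with hy
  set z : AA H := Complex.I • (x - star x) with hz
  have sy : star y = y := by rw [hy, star_add, star_star, add_comm]
  have sz : star z = z := by
    rw [hz, star_smul, star_sub, star_star]
    simp [smul_sub]; abel
  have e : x = (2⁻¹ : ℂ) • (y + (-Complex.I) • z) := by
    rw [hy, hz, smul_smul]
    simp only [neg_mul, Complex.I_mul_I, neg_neg, one_smul]
    rw [add_add_sub_cancel, ← two_smul ℂ, smul_smul]; norm_num
  have key : ∀ w, J2 Φ.toLinearMap y w → J2 Φ.toLinearMap z w → J2 Φ.toLinearMap x w := by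
    intro w h h'
    rw [e]; exact J2.smul_left _ (h.add_left (h'.smul_left _))
  have := key x (key y (hsa _ _ sy sy) (hsa _ _ sz sy)).symm (key z (hsa _ _ sy sz) (hsa _ _ sz sz)).symm
  unfold J2 at this
  apply two_cancel
  rw [← map_add]; exact this

end main
end TopRefl

namespace TopRefl
set_option linter.unusedSectionVars false
section loc
variable {H : Type*} [NormedAddCommGroup H] [InnerProductSpace ℂ H] [CompleteSpace H] [Nontrivial H]

/-- algebra automorphisms -/
def Auto (Ψ : AA H →ₗ[ℂ] AA H) : Prop :=
  Function.Bijective Ψ ∧ ∀ a b, Ψ (a * b) = Ψ a * Ψ b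

/-- the locality hypothesis -/
def Loc (Φ : AA H →L[ℂ] AA H) : Prop :=
  ∀ x, Φ x ∈ closure {y | ∃ Ψ : AA H →ₗ[ℂ] AA H, Auto Ψ ∧ y = Ψ x}

theorem Loc.closed {Φ : AA H →L[ℂ] AA H} (h : Loc Φ) {C : Set (AA H)} (hC : IsClosed C) (x : AA H)
    (hx : ∀ Ψ : AA H →ₗ[ℂ] AA H, Auto Ψ → Ψ x ∈ C) : Φ x ∈ C := by
  refine closure_minimal ?_ hC (h x)
  rintro _ ⟨Ψ, hΨ, rfl⟩; exact hx Ψ hΨ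

theorem Loc.approx {Φ : AA H →L[ℂ] AA H} (h : Loc Φ) (x : AA H) {ε : ℝ} (hε : 0 < ε) :
    ∃ Ψ : AA H →ₗ[ℂ] AA H, Auto Ψ ∧ ‖Φ x - Ψ x‖ < ε := by
  obtain ⟨_, ⟨Ψ, hΨ, rfl⟩, hy⟩ := Metric.mem_closure_iff.1 (h x) ε hε
  exact ⟨Ψ, hΨ, by rwa [← dist_eq_norm]⟩

theorem Auto.one {Ψ : AA H →ₗ[ℂ] AA H} (h : Auto Ψ) : Ψ 1 = 1 := by
  obtain ⟨a, ha⟩ := h.1.2 1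
  have := h.2 a 1
  rw [mul_one, ha, one_mul] at this
  exact this.symm

theorem Loc.idem {Φ : AA H →L[ℂ] AA H} (h : Loc Φ) (p : AA H) (hp : p * p = p) :
    Φ p * Φ p = Φ p := by
  refine h.closed (C := {y | y * y = y}) (isClosed_eq (by fun_prop) (by fun_prop)) p ?_
  intro Ψ hΨ
  change Ψ p * Ψ p = Ψ p
  rw [← hΨ.2, hp]

theorem Loc.one {Φ : AA H →L[ℂ] AA H} (h : Loc Φ) : Φ 1 = 1 :=
  h.closed (C := {1}) isClosed_singleton 1 fun _ hΨ => hΨ.one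

theorem Loc.jordan {Φ : AA H →L[ℂ] AA H} (h : Loc Φ) (x : AA H) : Φ (x * x) = Φ x * Φ x :=
  jordan_all Φ h.idem h.one x

/-- the generalized rank one identity passes to the image -/
theorem Loc.rkid {Φ : AA H →L[ℂ] AA H} (h : Loc Φ) (x : AA H)
    (hx : ∀ a b, x * a * x * b * x = x * b * x * a * x) (a b : AA H) :
    Φ x * a * Φ x * b * Φ x = Φ x * b * Φ x * a * Φ x := by
  refine h.closed (C := {y | y * a * y * b * y = y * b * y * a * y})
    (isClosed_eq (by fun_prop) (by fun_prop)) x ?_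
  intro Ψ hΨ
  obtain ⟨a, rfl⟩ := hΨ.1.2 a
  obtain ⟨b, rfl⟩ := hΨ.1.2 b
  change Ψ x * Ψ a * Ψ x * Ψ b * Ψ x = Ψ x * Ψ b * Ψ x * Ψ a * Ψ x
  simp only [← hΨ.2, hx a b]

/-- the coordinate maps -/
noncomputable def co (Φ : AA H →L[ℂ] AA H) (n : ℕ) : AA H →ₗ[ℂ] (H →L[ℂ] H) where
  toFun x := Φ x n
  map_add' x y := by rw [map_add]; rfl
  map_smul' c x := by rw [map_smul]; rfl

@[simp] theorem co_apply (Φ : AA H →L[ℂ] AA H) (n : ℕ) (x : AA H) : co Φ n x = Φ x n := rfl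

theorem co_bound (Φ : AA H →L[ℂ] AA H) (n : ℕ) (x : AA H) : ‖co Φ n x‖ ≤ ‖Φ‖ * ‖x‖ :=
  (norm_ap_le _ n).trans (Φ.le_opNorm x)

theorem Loc.co_jordan {Φ : AA H →L[ℂ] AA H} (h : Loc Φ) (n : ℕ) (x : AA H) :
    co Φ n (x * x) = co Φ n x * co Φ n x := by
  simp only [co_apply, h.jordan x]; rfl

theorem Loc.co_one {Φ : AA H →L[ℂ] AA H} (h : Loc Φ) (n : ℕ) : co Φ n 1 = 1 := by
  simp only [co_apply, h.one]; rfl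

/-- coordinate embedding -/
noncomputable def sg (m : ℕ) (A : H →L[ℂ] H) : AA H := lp.single ∞ m A

theorem sg_self (m : ℕ) (A : H →L[ℂ] H) : sg m A m = A := by
  simp [sg]

theorem sg_ne {m n : ℕ} (h : n ≠ m) (A : H →L[ℂ] H) : sg m A n = 0 := by
  simp [sg, h]

theorem sg_ap (m n : ℕ) (A : H →L[ℂ] H) : sg m A n = if n = m then A else 0 := by
  split_ifs with h
  · subst h; exact sg_self _ _
  · exact sg_ne h A

theorem sg_mul (m : ℕ) (A B : H →L[ℂ] H) : sg m A * sg m B = sg m (A * B) := by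
  refine ext_ap fun n => ?_
  simp only [mul_ap, sg_ap]; split_ifs <;> simp

theorem mul_sg (m : ℕ) (x : AA H) (B : H →L[ℂ] H) : x * sg m B = sg m (x m * B) := by
  refine ext_ap fun n => ?_
  simp only [mul_ap, sg_ap]; split_ifs with h
  · rw [h]
  · simp

theorem sg_mul' (m : ℕ) (x : AA H) (B : H →L[ℂ] H) : sg m B * x = sg m (B * x m) := by
  refine ext_ap fun n => ?_
  simp only [mul_ap, sg_ap]; split_ifs with h
  · rw [h]
  · simp

theorem sg_add (m : ℕ) (A B : H →L[ℂ] H) : sg m (A + B) = sg m A + sg m B := by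
  refine ext_ap fun n => ?_
  simp only [add_ap, sg_ap]; split_ifs <;> simp

theorem sg_smul (m : ℕ) (c : ℂ) (A : H →L[ℂ] H) : sg m (c • A) = c • sg m A := by
  refine ext_ap fun n => ?_
  simp only [smul_ap, sg_ap]; split_ifs <;> simp

theorem sg_zero (m : ℕ) : sg m (0 : H →L[ℂ] H) = 0 := by
  refine ext_ap fun n => ?_
  simp only [zero_ap, sg_ap]; split_ifs <;> simp

theorem sg_mul_ne {m n : ℕ} (h : m ≠ n) (A B : H →L[ℂ] H) : sg m A * sg n B = 0 := by
  rw [mul_sg, sg_ne h.symm, zero_mul, sg_zero]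

theorem norm_sg_le (m : ℕ) (A : H →L[ℂ] H) : ‖sg m A‖ ≤ ‖A‖ := by
  refine norm_le_of (norm_nonneg _) fun n => ?_
  rw [sg_ap]; split_ifs <;> simp

theorem norm_sg (m : ℕ) (A : H →L[ℂ] H) : ‖sg m A‖ = ‖A‖ := by
  refine le_antisymm (norm_sg_le m A) ?_
  have := norm_ap_le (sg m A) m
  rwa [sg_self] at this

end loc

section rk
variable {H : Type*} [NormedAddCommGroup H] [InnerProductSpace ℂ H] [CompleteSpace H] [Nontrivial H]

/-- rank one operator `z ↦ ⟪y,z⟫ x` -/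
noncomputable def rk (x y : H) : H →L[ℂ] H := InnerProductSpace.rankOne ℂ x y

theorem rk_ap (x y z : H) : rk x y z = inner ℂ y z • x := by
  simp [rk]

theorem rk_mul (x y u v : H) : rk x y * rk u v = (inner ℂ y u : ℂ) • rk x v := by
  ext z
  simp only [mul_apply_eq_comp, rk_ap, inner_smul_right, smul_apply, smul_smul]
  rw [mul_comm]

theorem mul_rk (A : H →L[ℂ] H) (x y : H) : A * rk x y = rk (A x) y := by
  ext z
  simp [mul_apply_eq_comp, rk_ap]

theorem norm_rk (x y : H) : ‖rk x y‖ = ‖x‖ * ‖y‖ := by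
  simp [rk]

/-- primeness of `B(H)` -/
theorem prime_BH {A B : H →L[ℂ] H} (h : ∀ C : H →L[ℂ] H, A * C * B = 0) : A = 0 ∨ B = 0 := by
  by_contra hcon
  push Not at hcon
  obtain ⟨hA, hB⟩ := hcon
  obtain ⟨u, hu⟩ : ∃ u, A u ≠ 0 := by
    by_contra h'; push Not at h'; exact hA (ContinuousLinearMap.ext h')
  obtain ⟨v, hv⟩ : ∃ v, B v ≠ 0 := by
    by_contra h'; push Not at h'; exact hB (ContinuousLinearMap.ext h')
  have := congrArg (fun T : H →L[ℂ] H => T v) (h (rk u (B v)))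
  simp [mul_apply_eq_comp, rk_ap, hu, hv] at this

theorem rk_idem_rank {Q : H →L[ℂ] H}
    (h : ∀ a b : H →L[ℂ] H, Q * a * Q * b * Q = Q * b * Q * a * Q) (v : H) (hv : v ≠ 0)
    (hQ : Q v = v) (w : H) : ∃ c : ℂ, Q w = c • v := by
  have := congrArg (fun T : H →L[ℂ] H => T v) (h (rk w v) (rk v v))
  simp only [mul_apply_eq_comp, rk_ap, map_smul, hQ, smul_smul] at this
  have hne : (inner ℂ v v : ℂ) * inner ℂ v v ≠ 0 :=
    mul_ne_zero (inner_self_ne_zero.2 hv) (inner_self_ne_zero.2 hv)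
  refine ⟨(inner ℂ v v * inner ℂ v v : ℂ)⁻¹ * (inner ℂ v v * inner ℂ v (Q w)), ?_⟩
  rw [mul_smul, ← this, inv_smul_smul₀ hne]

end rk
end TopRefl

namespace TopRefl
set_option linter.unusedSectionVars false
section basis
variable {H : Type*} [NormedAddCommGroup H] [InnerProductSpace ℂ H] [CompleteSpace H] [Nontrivial H]

theorem countable_of_sep {X ι : Type*} [PseudoMetricSpace X] [TopologicalSpace.SeparableSpace X]
    (f : ι → X) {δ : ℝ} (hδ : 0 < δ) (h : ∀ i j, i ≠ j → δ ≤ dist (f i) (f j)) : Countable ι := by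
  cases isEmpty_or_nonempty ι
  · infer_instance
  have : Nonempty X := ⟨f (Classical.arbitrary ι)⟩
  obtain ⟨u, hu⟩ := TopologicalSpace.exists_dense_seq X
  choose n hn using fun i => Metric.denseRange_iff.1 hu (f i) (δ / 2) (by positivity)
  refine Function.Injective.countable (f := n) fun i j hij => ?_
  by_contra hne
  have h1 := h i j hne
  have h2 := hn i
  have h3 := hn j
  rw [hij] at h2
  have := dist_triangle_right (f i) (f j) (u (n j))
  linarith

theorem exists_basis [TopologicalSpace.SeparableSpace H] (hinf : ¬ FiniteDimensional ℂ H) :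
    Nonempty (HilbertBasis ℕ ℂ H) := by
  obtain ⟨w, b, hb⟩ := exists_hilbertBasis ℂ H
  have hc : Countable w := by
    refine countable_of_sep (f := fun i => b i) (δ := 1) one_pos fun i j hij => ?_
    have h1 : ‖b i - b j‖ * ‖b i - b j‖ = 2 := by
      have h2 := @norm_sub_mul_self ℂ _ _ _ _ (b i) (b j)
      rw [b.orthonormal.2 hij, b.orthonormal.1 i, b.orthonormal.1 j] at h2
      rw [h2]; norm_num
    rw [dist_eq_norm]
    nlinarith [norm_nonneg (b i - b j)]
  have hi : Infinite w := by
    by_contra hfin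
    rw [not_infinite_iff_finite] at hfin
    have := Fintype.ofFinite w
    exact hinf b.toOrthonormalBasis.toBasis.finiteDimensional_of_finite
  obtain ⟨e⟩ := nonempty_equiv_of_countable (α := ℕ) (β := w)
  refine ⟨HilbertBasis.mk (b.orthonormal.comp e e.injective) ?_⟩
  rw [Set.range_comp, e.range_eq_univ, Set.image_univ]
  exact b.dense_span.ge

theorem ext_basis (b : HilbertBasis ℕ ℂ H) {S T : H →L[ℂ] H} (h : ∀ k, S (b k) = T (b k)) :
    S = T := by
  refine ContinuousLinearMap.ext_on (s := Set.range b) ?_ ?_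
  · have := b.dense_span
    rw [Submodule.dense_iff_topologicalClosure_eq_top]; exact this
  · rintro _ ⟨k, rfl⟩; exact h k

theorem exists_iso (b : HilbertBasis ℕ ℂ H) (g : ℕ → ℕ) (hg : Function.Injective g) :
    ∃ V : H →L[ℂ] H, (∀ i, V (b i) = b (g i)) ∧ star V * V = 1 ∧ ‖V‖ ≤ 1 ∧
      (∀ i, star V (b (g i)) = b i) ∧ ∀ k, k ∉ Set.range g → star V (b k) = 0 := by
  have ho := b.orthonormal.comp g hg
  let V0 : H →ₗᵢ[ℂ] H := ho.orthogonalFamily.linearIsometry.comp b.repr.toLinearIsometry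
  let V : H →L[ℂ] H := V0.toContinuousLinearMap
  have h1 : ∀ i, V (b i) = b (g i) := by
    intro i
    change ho.orthogonalFamily.linearIsometry (b.repr (b i)) = _
    rw [b.repr_self, OrthogonalFamily.linearIsometry_apply_single]
    simp
  have h2 : star V * V = 1 := by
    refine (ContinuousLinearMap.norm_map_iff_adjoint_comp_self V).1 fun x => V0.norm_map x
  refine ⟨V, h1, h2, V0.norm_toContinuousLinearMap_le, fun i => ?_, fun k hk => ?_⟩
  · rw [← h1]
    have := congrArg (fun T : H →L[ℂ] H => T (b i)) h2
    exact this
  · apply b.repr.injective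
    ext i
    rw [b.repr_apply_apply, ContinuousLinearMap.star_eq_adjoint,
      ContinuousLinearMap.adjoint_inner_right, h1, b.orthonormal.2]
    · simp
    · rintro rfl; exact hk ⟨i, rfl⟩

/-- the index maps used in the uncountable family -/
noncomputable def gg (r : ℝ) (m i : ℕ) : ℕ := Nat.pair i ⌊r * ((i : ℝ) + m)⌋₊

theorem gg_inj (r : ℝ) (m : ℕ) : Function.Injective (gg r m) := fun i j h => by
  have := congrArg Nat.unpair h
  simp only [gg, Nat.unpair_pair] at this
  exact (Prod.ext_iff.1 this).1

theorem gg_finite {r t : ℝ} (hr : 0 < r) (ht : 0 < t) (hrt : r ≠ t) :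
    {q : ℕ × ℕ | q.2 ∈ Set.range (gg r q.1) ∧ q.2 ∈ Set.range (gg t q.1)}.Finite := by
  obtain ⟨N, hN⟩ := exists_nat_gt (1 / |r - t|)
  have hd : 0 < |r - t| := abs_pos.2 (sub_ne_zero.2 hrt)
  refine Set.Finite.subset (((Finset.range N ×ˢ Finset.range N).finite_toSet).image
    (fun q : ℕ × ℕ => (q.1, gg r q.1 q.2))) ?_
  rintro ⟨m, k⟩ ⟨⟨i, hi⟩, ⟨j, hj⟩⟩
  simp only at hi hj
  have h1 : gg r m i = gg t m j := hi.trans hj.symm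
  have := congrArg Nat.unpair h1
  simp only [gg, Nat.unpair_pair] at this
  obtain ⟨rfl, h2⟩ := Prod.ext_iff.1 this
  simp only at h2
  have p1 : 0 ≤ r * ((i : ℝ) + m) := by positivity
  have p2 : 0 ≤ t * ((i : ℝ) + m) := by positivity
  have a1 := Nat.floor_le p1
  have a2 := Nat.lt_floor_add_one (r * ((i : ℝ) + m))
  have a3 := Nat.floor_le p2
  have a4 := Nat.lt_floor_add_one (t * ((i : ℝ) + m))
  rw [h2] at a1 a2
  have : |r - t| * ((i : ℝ) + m) < 1 := by
    have e : |r - t| * ((i : ℝ) + m) = |(r - t) * ((i : ℝ) + m)| := by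
      rw [abs_mul, abs_of_nonneg (by positivity : (0:ℝ) ≤ (i : ℝ) + m)]
    rw [e, abs_lt]; constructor <;> nlinarith
  have h3 : ((i : ℝ) + m) < N := by
    refine lt_trans ?_ hN
    rw [lt_div_iff₀ hd]; linarith
  have h4 : i + m < N := by exact_mod_cast h3
  refine ⟨(m, i), ?_, by simp [hi]⟩
  simp; omega

theorem sum_p (b : HilbertBasis ℕ ℂ H) (F : Finset (ℕ × ℕ)) (n k : ℕ) :
    (∑ q ∈ F, sg q.1 (rk (b q.2) (b q.2))) n (b k) = if (n, k) ∈ F then b k else 0 := by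
  classical
  rw [sum_ap, sum_apply]
  have : ∀ q : ℕ × ℕ, (sg q.1 (rk (b q.2) (b q.2))) n (b k) = if q = (n, k) then b k else 0 := by
    rintro ⟨m, j⟩
    rw [sg_ap]
    by_cases h : n = m
    · subst h
      simp only [if_true, rk_ap, Prod.mk.injEq, true_and]
      rw [orthonormal_iff_ite.1 b.orthonormal]
      split_ifs with h <;> simp [h]
    · simp [h, Ne.symm h]
  simp only [this]
  rw [Finset.sum_ite_eq']

theorem lemmaK [TopologicalSpace.SeparableSpace H] (b : HilbertBasis ℕ ℂ H)
    (ρ : AA H →ₗ[ℂ] (H →L[ℂ] H)) (h : ∀ x, ρ (x * x) = ρ x * ρ x) (C : ℝ)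
    (hC : ∀ x, ‖ρ x‖ ≤ C * ‖x‖) (h0 : ∀ m j, ρ (sg m (rk (b j) (b j))) = 0) : ρ 1 = 0 := by
  classical
  choose V0 hV1 hV2 hV3 hV4 hV5 using fun (r : ℝ) (m : ℕ) => exists_iso b (gg r m) (gg_inj r m)
  let V : ℝ → AA H := fun r => mkA (V0 r) 1 (hV3 r)
  let W : ℝ → AA H := fun r => star (V r)
  have hWV : ∀ r, W r * V r = 1 := fun r => ext_ap fun n => hV2 r n
  let x : ℝ → AA H := fun r => V r * W r
  have hVn : ∀ r, ‖V r‖ ≤ 1 := fun r => norm_le_of zero_le_one (hV3 r)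
  have hxn : ∀ r, ‖x r‖ ≤ 1 := fun r => by
    refine (norm_mul_le _ _).trans ?_
    rw [show ‖W r‖ = ‖V r‖ from norm_star _]
    exact mul_le_one₀ (hVn r) (norm_nonneg _) (hVn r)
  have hxi : ∀ r, x r * x r = x r := fun r => by
    change V r * W r * (V r * W r) = V r * W r
    rw [mul_assoc, ← mul_assoc (W r), hWV, one_mul]
  have hxa : ∀ r n k, x r n (b k) = if k ∈ Set.range (gg r n) then b k else 0 := by
    intro r n k
    change V0 r n (star (V0 r n) (b k)) = _
    split_ifs with hk
    · obtain ⟨i, rfl⟩ := hk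
      rw [hV4, hV1]
    · rw [hV5 _ _ _ hk, map_zero]
  have hprod : ∀ r t, 0 < r → 0 < t → r ≠ t → ρ (x r * x t) = 0 := by
    intro r t hr ht hrt
    have hf := gg_finite hr ht hrt
    have e : x r * x t = ∑ q ∈ hf.toFinset, sg q.1 (rk (b q.2) (b q.2)) := by
      refine ext_ap fun n => ext_basis b fun k => ?_
      rw [sum_p, mul_ap, mul_apply_eq_comp, hxa]
      by_cases h1 : k ∈ Set.range (gg t n)
      · rw [if_pos h1, hxa]
        by_cases h2 : k ∈ Set.range (gg r n)
        · rw [if_pos h2, if_pos]; simpa using ⟨h2, h1⟩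
        · rw [if_neg h2, if_neg]
          intro hh; rw [Set.Finite.mem_toFinset] at hh; exact h2 hh.1
      · rw [if_neg h1, map_zero, if_neg]
        intro hh; rw [Set.Finite.mem_toFinset] at hh; exact h1 hh.2
    rw [e, map_sum]
    exact Finset.sum_eq_zero fun q _ => h0 _ _
  have hρi : ∀ p, p * p = p → ρ p * ρ p = ρ p := fun p hp => by rw [← h, hp]
  have horth : ∀ r t, 0 < r → 0 < t → r ≠ t → ρ (x r) * ρ (x t) = 0 := by
    intro r t hr ht hrt
    refine orth_of_anti (hρi _ (hxi r)) ?_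
    rw [← jordan_mul ρ h, map_add, hprod r t hr ht hrt, hprod t r ht hr hrt.symm, add_zero]
  by_cases hz : ∃ r, ρ (x r) = 0
  · obtain ⟨r, hr⟩ := hz
    have h3 := jordan_triple3 ρ h (W r) (x r) (V r)
    have e1 : W r * x r * V r = 1 := by
      change W r * (V r * W r) * V r = 1
      rw [← mul_assoc, hWV, one_mul, hWV]
    rw [hr, e1] at h3
    have hy : V r * x r * W r * (V r * x r * W r) = V r * x r * W r := by
      calc V r * x r * W r * (V r * x r * W r) = V r * x r * (W r * V r) * (x r * W r) := by
            noncomm_ring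
        _ = V r * (x r * x r) * W r := by rw [hWV]; noncomm_ring
        _ = _ := by rw [hxi]
    have hy2 := hρi _ hy
    have h12 := hρi 1 (one_mul 1)
    rw [map_add] at h3
    have h4 : ρ (V r * x r * W r) = - ρ 1 := by
      rw [eq_neg_iff_add_eq_zero, add_comm, h3]; simp
    rw [h4, neg_mul_neg, h12] at hy2
    have : ρ 1 + ρ 1 = 0 + 0 := by nth_rewrite 1 [hy2]; simp
    exact two_cancel this
  · exfalso
    push Not at hz
    have hv : ∀ r : ℝ, ∃ v : H, ‖v‖ = 1 ∧ ρ (x r) v = v := by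
      intro r
      obtain ⟨u, hu⟩ : ∃ u, ρ (x r) u ≠ 0 := by
        by_contra h'; push Not at h'; exact hz r (ContinuousLinearMap.ext h')
      refine ⟨((‖ρ (x r) u‖⁻¹ : ℝ) : ℂ) • ρ (x r) u, ?_, ?_⟩
      · rw [norm_smul]; simp [hu]
      · rw [map_smul]
        congr 1
        exact congrArg (fun T : H →L[ℂ] H => T u) (hρi _ (hxi r))
    choose v hv1 hv2 using hv
    have hcnt : Countable ℝ := by
      refine countable_of_sep (f := fun r : ℝ => v (Real.exp r)) (δ := (|C| + 1)⁻¹) (by positivity)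
        fun r t hrt => ?_
      have hrt' : Real.exp r ≠ Real.exp t := fun hh => hrt (Real.exp_injective hh)
      generalize hr : Real.exp r = r' at *
      generalize ht : Real.exp t = t' at *
      have o := horth r' t' (hr ▸ Real.exp_pos r) (ht ▸ Real.exp_pos t) hrt'
      have e : ρ (x r') (v r' - v t') = v r' := by
        rw [map_sub, hv2]
        have : ρ (x r') (v t') = 0 := by
          rw [← hv2 t', ← mul_apply_eq_comp, o]; rfl
        rw [this, sub_zero]
      have n1 : (1 : ℝ) ≤ (|C| + 1) * ‖v r' - v t'‖ := by
        calc (1 : ℝ) = ‖ρ (x r') (v r' - v t')‖ := by rw [e, hv1]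
          _ ≤ ‖ρ (x r')‖ * ‖v r' - v t'‖ := ContinuousLinearMap.le_opNorm _ _
          _ ≤ (|C| + 1) * ‖v r' - v t'‖ := by
            gcongr
            refine (hC _).trans ?_
            have := hxn r'
            calc C * ‖x r'‖ ≤ |C| * ‖x r'‖ := by gcongr; exact le_abs_self C
              _ ≤ |C| * 1 := by gcongr
              _ ≤ _ := by linarith
      rw [dist_eq_norm, inv_eq_one_div, div_le_iff₀ (by positivity)]
      linarith
    exact Cardinal.not_countable_real (Set.countable_univ)

end basis
end TopRefl

namespace TopRefl
set_option linter.unusedSectionVars false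
section coord
variable {H : Type*} [NormedAddCommGroup H] [InnerProductSpace ℂ H] [CompleteSpace H] [Nontrivial H]
  [TopologicalSpace.SeparableSpace H]

theorem lemmaK' (b : HilbertBasis ℕ ℂ H)
    (ρ : AA H →ₗ[ℂ] (H →L[ℂ] H)) (h : ∀ x, ρ (x * x) = ρ x * ρ x) (h1 : ρ 1 = 1) (C : ℝ)
    (hC : ∀ x, ‖ρ x‖ ≤ C * ‖x‖) (M : Submodule ℂ H) (hM : ∀ A, ∀ v ∈ M, ρ A v ∈ M)
    (hM2 : ∀ m j v, ρ (sg m (rk (b j) (b j))) v ∈ M) : Dense (M : Set H) := by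
  set E : H →L[ℂ] H := Mᗮ.starProjection with hE
  have hE0 : ∀ u ∈ M, E u = 0 := fun u hu => by
    rw [hE, Submodule.starProjection_apply_eq_zero_iff]
    exact Submodule.le_orthogonal_orthogonal M hu
  have hEA : ∀ A, ∀ u ∈ Mᗮᗮ, E (ρ A u) = 0 := by
    intro A u hu
    rw [Submodule.orthogonal_orthogonal_eq_closure] at hu
    have hcl : IsClosed {u | E (ρ A u) = 0} := isClosed_eq (by fun_prop) (by fun_prop)
    exact closure_minimal (fun u hu => hE0 _ (hM A u hu)) hcl hu
  have hid : ∀ v, E (E v) = E v := fun v =>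
    congrArg (fun T : H →L[ℂ] H => T v) (Mᗮ.isIdempotentElem_starProjection).eq
  have hkey : ∀ A v, E (ρ A (E v)) = E (ρ A v) := by
    intro A v
    have : v - E v ∈ Mᗮᗮ := by
      rw [← Submodule.starProjection_apply_eq_zero_iff, ← hE, map_sub, hid, sub_self]
    have := hEA A _ this
    rw [map_sub, map_sub, sub_eq_zero] at this
    exact this.symm
  let ρ' : AA H →ₗ[ℂ] (H →L[ℂ] H) := (LinearMap.mulLeft ℂ E).comp ρ
  have hρ' : ∀ x, ρ' x = E * ρ x := fun x => rfl
  have hz := lemmaK b ρ' (fun x => by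
      rw [hρ', hρ', h]
      ext v
      exact (hkey x (ρ x v)).symm) (‖E‖ * C) (fun x => by
      rw [hρ', mul_assoc]
      exact (norm_mul_le _ _).trans (by gcongr; exact hC x)) (fun m j => by
      rw [hρ']; ext v
      exact hE0 _ (hM2 m j v))
  rw [hρ', h1, mul_one] at hz
  rw [Submodule.dense_iff_topologicalClosure_eq_top, Submodule.topologicalClosure_eq_top_iff,
    Submodule.eq_bot_iff]
  intro u hu
  have := (Submodule.starProjection_eq_self_iff).2 hu
  rw [← hE, hz] at this
  exact this.symm

theorem rk_id {x : AA H} (hx : ∀ n, ∃ u v, x n = rk u v) (a c : AA H) :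
    x * a * x * c * x = x * c * x * a * x := by
  refine ext_ap fun n => ?_
  obtain ⟨u, v, h⟩ := hx n
  simp only [mul_ap, h]
  ext z
  simp only [mul_apply_eq_comp, rk_ap, map_smul, smul_smul]
  congr 1; ring

/-- the minimal projections -/
noncomputable def pp (b : HilbertBasis ℕ ℂ H) (m j : ℕ) : AA H := sg m (rk (b j) (b j))

theorem bb (b : HilbertBasis ℕ ℂ H) (j : ℕ) : (inner ℂ (b j) (b j) : ℂ) = 1 := by
  rw [orthonormal_iff_ite.1 b.orthonormal]; simp

theorem bb_ne (b : HilbertBasis ℕ ℂ H) {j k : ℕ} (h : j ≠ k) : (inner ℂ (b j) (b k) : ℂ) = 0 :=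
  b.orthonormal.2 h

theorem pp_idem (b : HilbertBasis ℕ ℂ H) (m j : ℕ) : pp b m j * pp b m j = pp b m j := by
  rw [pp, sg_mul, rk_mul, bb, one_smul]

theorem pp_rk (b : HilbertBasis ℕ ℂ H) (m j n : ℕ) : ∃ u v, pp b m j n = rk u v := by
  rw [pp, sg_ap]
  split_ifs
  · exact ⟨_, _, rfl⟩
  · exact ⟨0, 0, by ext z; simp [rk_ap]⟩

theorem Loc.co_rk {Φ : AA H →L[ℂ] AA H} (hΦ : Loc Φ) (n : ℕ) (x : AA H)
    (hx : ∀ n, ∃ u v, x n = rk u v) (v : H) (hv : v ≠ 0) (hQ : co Φ n x v = v) (w : H) :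
    ∃ c : ℂ, co Φ n x w = c • v := by
  refine rk_idem_rank (fun a c => ?_) v hv hQ w
  have := congrArg (fun z : AA H => z n) (hΦ.rkid x (rk_id hx) (sg n a) (sg n c))
  simp only [mul_ap, sg_self] at this
  exact this

theorem exists_fix {Q : H →L[ℂ] H} (hQ : Q * Q = Q) (h0 : Q ≠ 0) : ∃ f : H, ‖f‖ = 1 ∧ Q f = f := by
  obtain ⟨u, hu⟩ : ∃ u, Q u ≠ 0 := by
    by_contra h'; push Not at h'; exact h0 (ContinuousLinearMap.ext h')
  refine ⟨((‖Q u‖⁻¹ : ℝ) : ℂ) • Q u, ?_, ?_⟩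
  · rw [norm_smul]; simp [hu]
  · rw [map_smul]
    congr 1
    exact congrArg (fun T : H →L[ℂ] H => T u) hQ

theorem Loc.co_other {Φ : AA H →L[ℂ] AA H} (hΦ : Loc Φ) (b : HilbertBasis ℕ ℂ H) (n : ℕ)
    {m m' j j' : ℕ} (hne : m ≠ m') (hm : co Φ n (pp b m j) ≠ 0) : co Φ n (pp b m' j') = 0 := by
  by_contra hm'
  have hJ := hΦ.co_jordan n
  have hid : ∀ m j, co Φ n (pp b m j) * co Φ n (pp b m j) = co Φ n (pp b m j) := fun m j => by
    rw [← hJ, pp_idem]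
  obtain ⟨f, hf1, hf⟩ := exists_fix (hid m j) hm
  obtain ⟨g, hg1, hg⟩ := exists_fix (hid m' j') hm'
  have hf0 : f ≠ 0 := by rintro rfl; simp at hf1
  have hg0 : g ≠ 0 := by rintro rfl; simp at hg1
  have hanti := jordan_mul (co Φ n) hJ (pp b m j) (pp b m' j')
  rw [show pp b m j * pp b m' j' = 0 from sg_mul_ne hne _ _,
    show pp b m' j' * pp b m j = 0 from sg_mul_ne hne.symm _ _, add_zero, map_zero] at hanti
  have o1 := orth_of_anti (hid m j) hanti.symm
  have o2 := orth_of_anti (hid m' j') ((add_comm _ _).trans hanti.symm)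
  have a1 : co Φ n (pp b m j) g = 0 := by
    rw [← hg, ← mul_apply_eq_comp, o1]; rfl
  have a2 : co Φ n (pp b m' j') f = 0 := by
    rw [← hf, ← mul_apply_eq_comp, o2]; rfl
  obtain ⟨c, hc⟩ := hΦ.co_rk n (pp b m j + pp b m' j') (fun k => by
    rw [add_ap]
    by_cases hk : k = m
    · obtain ⟨u, v, h⟩ := pp_rk b m j k
      refine ⟨u, v, ?_⟩
      rw [h, pp, sg_ne (hk ▸ hne), add_zero]
    · obtain ⟨u, v, h⟩ := pp_rk b m' j' k
      refine ⟨u, v, ?_⟩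
      rw [h, pp, sg_ne hk, zero_add]) f hf0 (by rw [map_add, add_apply, hf, a2, add_zero]) g
  rw [map_add, add_apply, a1, hg, zero_add] at hc
  rw [hc, map_smul, hf, ← hc] at a1
  exact hg0 a1

set_option maxHeartbeats 2000000 in
theorem Loc.coord {Φ : AA H →L[ℂ] AA H} (hΦ : Loc Φ) (b : HilbertBasis ℕ ℂ H) (n : ℕ) :
    ∃ (m j : ℕ) (f : H), ‖f‖ = 1 ∧ co Φ n (pp b m j) f = f ∧
      (((∀ A X, co Φ n A (co Φ n (X * pp b m j) f) = co Φ n (A * X * pp b m j) f) ∧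
        Dense (Set.range fun X => co Φ n (X * pp b m j) f) ∧
        ∀ A A', co Φ n (A * A') = co Φ n A * co Φ n A') ∨
      ∀ A A', co Φ n (A * A') = co Φ n A' * co Φ n A) := by
  have hJ := hΦ.co_jordan n
  have hid : ∀ m j, co Φ n (pp b m j) * co Φ n (pp b m j) = co Φ n (pp b m j) := fun m j => by
    rw [← hJ, pp_idem]
  obtain ⟨m, j, hmj⟩ : ∃ m j, co Φ n (pp b m j) ≠ 0 := by
    by_contra hcon
    push Not at hcon
    have := lemmaK b (co Φ n) hJ ‖Φ‖ (co_bound Φ n) hcon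
    rw [hΦ.co_one] at this
    exact one_ne_zero this
  obtain ⟨f, hf1, hf⟩ := exists_fix (hid m j) hmj
  have hf0 : f ≠ 0 := by rintro rfl; simp at hf1
  refine ⟨m, j, f, hf1, hf, ?_⟩
  have hj : j ≠ j + 1 := by omega
  have hmin : ∀ Z, ∃ c : ℂ, pp b m j * Z * pp b m j = c • pp b m j := fun Z => by
    refine ⟨inner ℂ (b j) (Z m (b j)), ?_⟩
    rw [pp, sg_mul', sg_mul, mul_assoc, mul_rk, rk_mul, sg_smul]
  set X0 : AA H := sg m (rk (b (j + 1)) (b j)) with hX0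
  set Y0 : AA H := sg m (rk (b j) (b (j + 1))) with hY0
  have hX1 : X0 * pp b m j = X0 := by rw [hX0, pp, sg_mul, rk_mul, bb, one_smul]
  have hX2 : pp b m j * X0 = 0 := by rw [hX0, pp, sg_mul, rk_mul, bb_ne b hj, zero_smul, sg_zero]
  have hY1 : pp b m j * Y0 = Y0 := by rw [hY0, pp, sg_mul, rk_mul, bb, one_smul]
  have hY2 : Y0 * pp b m j = 0 := by
    rw [hY0, pp, sg_mul, rk_mul, bb_ne b hj.symm, zero_smul, sg_zero]
  have hYX : Y0 * X0 = pp b m j := by rw [hY0, hX0, pp, sg_mul, rk_mul, bb, one_smul]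
  have hQ := hΦ.co_rk n (pp b m j) (pp_rk b m j) f hf0 hf
  rcases peirce_dich (B := AA H) (H := H) (co Φ n) hJ (pp b m j) f hf0 hf hQ X0 Y0 hX1 hX2 hY1 hY2 hYX with hc | hc
  · left
    have hitw := intertwine (B := AA H) (H := H) (co Φ n) hJ (pp b m j) (pp_idem b m j) hmin f hf X0 Y0 hX1 hX2 hY1 hY2
      hYX hc
    refine ⟨hitw, mult_of_intertwine (B := AA H) (H := H) (co Φ n) (pp b m j) f hf0 hf hitw
      {p | ∃ m' j', p = pp b m' j'} ?_ ?_ ?_⟩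
    · rintro _ ⟨m', j', rfl⟩
      by_cases hm : m = m'
      · right
        subst hm
        refine ⟨sg m (rk (b j') (b j)), sg m (rk (b j) (b j')), ?_, ?_, ?_⟩ <;>
          rw [pp, sg_mul, rk_mul, bb, one_smul]
      · left; exact hΦ.co_other b n hm hmj
    · rintro _ ⟨m', j', rfl⟩ v hv hv2 w
      exact hΦ.co_rk n _ (pp_rk b m' j') v hv hv2 w
    · intro M hM hM2
      exact lemmaK' b (co Φ n) hJ (hΦ.co_one n) ‖Φ‖ (co_bound Φ n) M hM
        fun m' j' v => hM2 _ ⟨m', j', rfl⟩ v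
  · right
    let ρ : (AA H)ᵐᵒᵖ →ₗ[ℂ] (H →L[ℂ] H) :=
      (co Φ n).comp (MulOpposite.opLinearEquiv ℂ).symm.toLinearMap
    have hρ : ∀ x, ρ (MulOpposite.op x) = co Φ n x := fun x => rfl
    have hρ' : ∀ x, ρ x = co Φ n x.unop := fun x => rfl
    have hJ' : ∀ x, ρ (x * x) = ρ x * ρ x := fun x => hJ x.unop
    have hitw := intertwine (B := (AA H)ᵐᵒᵖ) (H := H) ρ hJ' (MulOpposite.op (pp b m j))
      (congrArg MulOpposite.op (pp_idem b m j)) (fun Z => by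
        obtain ⟨c, hc⟩ := hmin Z.unop
        refine ⟨c, ?_⟩
        apply MulOpposite.unop_injective
        simp only [MulOpposite.unop_mul, MulOpposite.unop_op, MulOpposite.unop_smul, ← mul_assoc]
        exact hc) f hf (MulOpposite.op Y0) (MulOpposite.op X0)
      (congrArg MulOpposite.op hY1) (congrArg MulOpposite.op hY2)
      (congrArg MulOpposite.op hX1) (congrArg MulOpposite.op hX2)
      (congrArg MulOpposite.op hYX) (fun X h1 h2 => hc X.unop
        (congrArg MulOpposite.unop h1) (congrArg MulOpposite.unop h2))
    have := (mult_of_intertwine (B := (AA H)ᵐᵒᵖ) (H := H) ρ (MulOpposite.op (pp b m j)) f hf0 hf hitw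
      {p | ∃ m' j', p = MulOpposite.op (pp b m' j')} ?_ ?_ ?_).2
    · intro A A'
      exact this (MulOpposite.op A') (MulOpposite.op A)
    · rintro _ ⟨m', j', rfl⟩
      by_cases hm : m = m'
      · right
        subst hm
        refine ⟨MulOpposite.op (sg m (rk (b j) (b j'))), MulOpposite.op (sg m (rk (b j') (b j))),
          ?_, ?_, ?_⟩ <;>
          rw [pp, ← MulOpposite.op_mul, sg_mul, rk_mul, bb, one_smul]
      · left; exact hΦ.co_other b n hm hmj
    · rintro _ ⟨m', j', rfl⟩ v hv hv2 w
      exact hΦ.co_rk n _ (pp_rk b m' j') v hv hv2 w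
    · intro M hM hM2
      exact lemmaK' b (co Φ n) hJ (hΦ.co_one n) ‖Φ‖ (co_bound Φ n) M (fun A => hM (MulOpposite.op A))
        fun m' j' v => hM2 _ ⟨m', j', rfl⟩ v

end coord
end TopRefl

namespace TopRefl
set_option linter.unusedSectionVars false
section fin
variable {H : Type*} [NormedAddCommGroup H] [InnerProductSpace ℂ H] [CompleteSpace H] [Nontrivial H]
  [TopologicalSpace.SeparableSpace H]

theorem exists_ap_ne {a : AA H} (h : a ≠ 0) : ∃ m, a m ≠ 0 := by
  by_contra hcon; push Not at hcon; exact h (ext_ap hcon)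

theorem sg_one_ne (n : ℕ) : sg n (1 : H →L[ℂ] H) ≠ 0 := fun h => by
  have := congrArg (fun z : AA H => z n) h
  simp only [sg_self, zero_ap] at this
  exact one_ne_zero this

theorem Auto.ne_zero {Ψ : AA H →ₗ[ℂ] AA H} (h : Auto Ψ) (x : AA H) (hx : ∀ m, x m ≠ 0) (n : ℕ) :
    Ψ x n ≠ 0 := by
  intro h0
  obtain ⟨a, ha⟩ := h.1.2 (sg n 1)
  have hz : ∀ c, a * c * x = 0 := fun c => by
    apply h.1.1
    rw [h.2, h.2, ha, sg_mul', sg_mul', mul_assoc, h0, mul_zero, mul_zero, sg_zero, map_zero]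
  have ha0 : a ≠ 0 := by
    rintro rfl
    rw [map_zero] at ha
    exact sg_one_ne n ha.symm
  obtain ⟨m, hm⟩ := exists_ap_ne ha0
  rcases prime_BH (A := a m) (B := x m) (fun C => by
    have := congrArg (fun z : AA H => z m) (hz (sg m C))
    simpa only [mul_ap, sg_self, zero_ap] using this) with h1 | h1
  · exact hm h1
  · exact hx m h1

theorem Loc.not_anti {Φ : AA H →L[ℂ] AA H} (hΦ : Loc Φ) (b : HilbertBasis ℕ ℂ H) (n : ℕ)
    (h : ∀ A A', co Φ n (A * A') = co Φ n A' * co Φ n A) : False := by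
  obtain ⟨V, hV1, hV2, hV3, hV4, hV5⟩ := exists_iso b Nat.succ Nat.succ_injective
  let S : AA H := mkA (fun _ => V) 1 (fun _ => hV3)
  have hSS : star S * S = 1 := ext_ap fun _ => hV2
  have h1 := h (star S) S
  rw [hSS, hΦ.co_one] at h1
  set D := co Φ n (star S) with hD
  obtain ⟨Ψ, hΨ, hd⟩ := hΦ.approx S (ε := (‖D‖ + 1)⁻¹) (by positivity)
  set T := Ψ S n with hT
  set L := Ψ (star S) n with hL
  have hLT : L * T = 1 := by
    rw [hL, hT, ← mul_ap, ← hΨ.2, hSS, hΨ.one, one_ap]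
  have hlt : ‖(co Φ n S - T) * D‖ < 1 := by
    have h2 : ‖co Φ n S - T‖ < (‖D‖ + 1)⁻¹ := (norm_ap_le (Φ S - Ψ S) n).trans_lt hd
    calc _ ≤ ‖co Φ n S - T‖ * ‖D‖ := norm_mul_le _ _
      _ ≤ (‖D‖ + 1)⁻¹ * ‖D‖ := by gcongr
      _ < 1 := by rw [inv_mul_lt_iff₀ (by positivity)]; linarith
  have hu := isUnit_one_sub_of_norm_lt_one hlt
  have e : 1 - (co Φ n S - T) * D = T * D := by rw [sub_mul, ← h1]; abel
  rw [e] at hu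
  obtain ⟨R, hR⟩ := hu.exists_right_inv
  have hTL : T * L = 1 := by
    calc T * L = T * L * (T * D * R) := by rw [hR, mul_one]
      _ = T * (L * T) * D * R := by noncomm_ring
      _ = 1 := by rw [hLT, mul_one, hR]
  refine hΨ.ne_zero (1 - S * star S) (fun m => ?_) n ?_
  · intro h0
    have := congrArg (fun A : H →L[ℂ] H => A (b 0)) h0
    change b 0 - V (star V (b 0)) = 0 at this
    rw [hV5 0 (by rintro ⟨k, hk⟩; exact Nat.succ_ne_zero k hk), map_zero V, sub_zero] at this
    exact b.orthonormal.ne_zero 0 this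
  · rw [map_sub, sub_ap, hΨ.2, mul_ap, hΨ.one, one_ap, ← hT, ← hL, hTL, sub_self]

theorem Loc.spatial {Φ : AA H →L[ℂ] AA H} (hΦ : Loc Φ) (b : HilbertBasis ℕ ℂ H) (n : ℕ) :
    ∃ (m : ℕ) (T T' : H →L[ℂ] H), T * T' = 1 ∧ T' * T = 1 ∧ ‖T‖ ≤ ‖Φ‖ ∧ ‖T'‖ ≤ ‖Φ‖ ∧
      ∀ x, Φ x n = T * x m * T' := by
  obtain ⟨m, j, f, hf1, hf, ⟨hitw, hdense, hmul⟩ | hanti⟩ := hΦ.coord b n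
  swap
  · exact (hΦ.not_anti b n hanti).elim
  have hbj : ‖b j‖ = 1 := b.orthonormal.1 j
  let T0 : H →ₗ[ℂ] H :=
    { toFun := fun x => co Φ n (sg m (rk x (b j))) f
      map_add' := fun x y => by
        have : rk (x + y) (b j) = rk x (b j) + rk y (b j) := by ext z; simp [rk_ap]
        rw [this, sg_add, map_add, add_apply]
      map_smul' := fun c x => by
        have : rk (c • x) (b j) = c • rk x (b j) := by
          ext z; simp only [rk_ap, smul_apply]; rw [smul_comm]
        rw [this, sg_smul, map_smul]; rfl }
  have hT0 : ∀ x, T0 x = co Φ n (sg m (rk x (b j))) f := fun _ => rfl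
  have hT0n : ∀ x, ‖T0 x‖ ≤ ‖Φ‖ * ‖x‖ := fun x => by
    rw [hT0]
    calc _ ≤ ‖co Φ n (sg m (rk x (b j)))‖ * ‖f‖ := ContinuousLinearMap.le_opNorm _ _
      _ ≤ ‖Φ‖ * ‖sg m (rk x (b j))‖ := by rw [hf1, mul_one]; exact co_bound _ _ _
      _ = ‖Φ‖ * ‖x‖ := by rw [norm_sg, norm_rk, hbj, mul_one]
  let T : H →L[ℂ] H := T0.mkContinuous ‖Φ‖ hT0n
  have hT : ∀ x, T x = co Φ n (sg m (rk x (b j))) f := fun _ => rfl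
  have hXp : ∀ X, X * pp b m j = sg m (rk (X m (b j)) (b j)) := fun X => by
    rw [pp, mul_sg, mul_rk]
  have hTX : ∀ X, co Φ n (X * pp b m j) f = T (X m (b j)) := fun X => by rw [hXp, hT]
  have hAT : ∀ A x, co Φ n A (T x) = T (A m x) := by
    intro A x
    have hx : (sg m (rk x (b j)) : AA H) m (b j) = x := by rw [sg_self, rk_ap, bb, one_smul]
    have := hitw A (sg m (rk x (b j)))
    rw [hTX, hTX, mul_ap, mul_apply_eq_comp, hx] at this
    exact this
  have hTb : T (b j) = f := hf
  have hlow : ∀ x, ‖x‖ ≤ ‖Φ‖ * ‖T x‖ := by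
    intro x
    by_cases hx : x = 0
    · subst hx; simp
    have h1 := hAT (sg m (rk (b j) x)) x
    rw [sg_self, rk_ap, map_smul, hTb] at h1
    have h2 : ‖x‖ * ‖x‖ ≤ (‖Φ‖ * ‖x‖) * ‖T x‖ := by
      calc ‖x‖ * ‖x‖ = ‖(inner ℂ x x : ℂ) • f‖ := by
            rw [norm_smul, hf1, mul_one, inner_self_eq_norm_sq_to_K]; simp [sq]
        _ = ‖co Φ n (sg m (rk (b j) x)) (T x)‖ := by rw [h1]
        _ ≤ ‖co Φ n (sg m (rk (b j) x))‖ * ‖T x‖ := ContinuousLinearMap.le_opNorm _ _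
        _ ≤ _ := by
          gcongr
          refine (co_bound _ _ _).trans ?_
          rw [norm_sg, norm_rk, hbj, one_mul]
    have hx' : 0 < ‖x‖ := norm_pos_iff.2 hx
    nlinarith
  have hanti : AntilipschitzWith ‖Φ‖₊ T :=
    AddMonoidHomClass.antilipschitz_of_bound T hlow
  have hinj : Function.Injective T := hanti.injective
  have hcl : IsClosed (Set.range T) := hanti.isClosed_range T.uniformContinuous
  have hsurj : Function.Surjective T := by
    rw [← Set.range_eq_univ]
    refine hcl.closure_eq.symm.trans (Dense.closure_eq ?_)
    refine hdense.mono ?_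
    rintro _ ⟨X, rfl⟩
    exact ⟨_, (hTX X).symm⟩
  let e := ContinuousLinearEquiv.ofBijective T (LinearMap.ker_eq_bot.2 hinj)
    (LinearMap.range_eq_top.2 hsurj)
  have he : ∀ x, e x = T x := fun _ => rfl
  have h1 : ∀ x, T (e.symm x) = x := fun x => e.apply_symm_apply x
  have h2 : ∀ x, e.symm (T x) = x := fun x => e.symm_apply_apply x
  refine ⟨m, T, (e.symm : H →L[ℂ] H), ContinuousLinearMap.ext h1, ContinuousLinearMap.ext h2,
    LinearMap.mkContinuous_norm_le _ Φ.opNorm_nonneg _,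
    ContinuousLinearMap.opNorm_le_bound _ Φ.opNorm_nonneg fun x => ?_, fun x => ?_⟩
  · have := hlow (e.symm x)
    rw [h1] at this
    exact this
  · ext v
    have := hAT x (e.symm v)
    rw [h1] at this
    exact this

theorem norm_idem_ge {p : AA H} (hp : p * p = p) (h0 : p ≠ 0) : 1 ≤ ‖p‖ := by
  have h1 : ‖p‖ ≤ ‖p‖ * ‖p‖ := by
    calc ‖p‖ = ‖p * p‖ := by rw [hp]
      _ ≤ _ := norm_mul_le _ _
  have h2 : 0 < ‖p‖ := norm_pos_iff.2 h0
  nlinarith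

theorem Loc.main {Φ : AA H →L[ℂ] AA H} (hΦ : Loc Φ) (b : HilbertBasis ℕ ℂ H) :
    Function.Bijective Φ ∧ ∀ x y, Φ (x * y) = Φ x * Φ y := by
  choose φ T T' hTT' hT'T hTn hT'n hsp using hΦ.spatial b
  have hidem : ∀ m, sg m (1 : H →L[ℂ] H) * sg m 1 = sg m 1 := fun m => by rw [sg_mul, mul_one]
  have hsurj : Function.Surjective φ := by
    intro m
    by_contra hcon
    push Not at hcon
    have h0 : Φ (sg m 1) = 0 := ext_ap fun n => by
      rw [hsp, sg_ne (hcon n), mul_zero, zero_mul, zero_ap]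
    obtain ⟨Ψ, hΨ, hd⟩ := hΦ.approx (sg m 1) one_pos
    rw [h0, zero_sub, norm_neg] at hd
    have := norm_idem_ge (p := Ψ (sg m 1)) (by rw [← hΨ.2, hidem]) (fun hh =>
      sg_one_ne m (hΨ.1.1 (hh.trans (map_zero Ψ).symm)))
    linarith
  have hinj : Function.Injective φ := by
    intro j k hjk
    by_contra hne
    obtain ⟨Ψ, hΨ, hd⟩ := hΦ.approx (sg (φ j) 1) one_pos
    have hne0 : ∀ i, φ i = φ j → Ψ (sg (φ j) 1) i ≠ 0 := by
      intro i hi h0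
      have h1 := (norm_ap_le (Φ (sg (φ j) 1) - Ψ (sg (φ j) 1)) i).trans_lt hd
      rw [sub_ap, h0, hsp, hi, sg_self, mul_one, hTT', sub_zero, norm_one] at h1
      exact lt_irrefl _ h1
    have key : ∀ i, φ i = φ j → ∃ a, Ψ a = sg i 1 ∧ a (φ j) ≠ 0 := by
      intro i hi
      obtain ⟨a, ha⟩ := hΨ.1.2 (sg i 1)
      refine ⟨a, ha, fun h0 => hne0 i hi ?_⟩
      have h1 : Ψ (a * sg (φ j) 1) = 0 := by rw [mul_sg, h0, zero_mul, sg_zero, map_zero]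
      rw [hΨ.2, ha, sg_mul', one_mul] at h1
      have := congrArg (fun z : AA H => z i) h1
      simpa only [sg_self, zero_ap] using this
    obtain ⟨a, ha, ha0⟩ := key j rfl
    obtain ⟨c, hc, hc0⟩ := key k hjk.symm
    have hz : ∀ d, a * d * c = 0 := fun d => by
      apply hΨ.1.1
      rw [hΨ.2, hΨ.2, ha, hc, sg_mul', sg_mul_ne hne, map_zero]
    rcases prime_BH (A := a (φ j)) (B := c (φ j)) (fun C => by
      have := congrArg (fun z : AA H => z (φ j)) (hz (sg (φ j) C))
      simpa only [mul_ap, sg_self, zero_ap] using this) with h1 | h1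
    · exact ha0 h1
    · exact hc0 h1
  refine ⟨⟨?_, ?_⟩, ?_⟩
  · rw [injective_iff_map_eq_zero]
    intro x hx
    refine ext_ap fun m => ?_
    obtain ⟨n, rfl⟩ := hsurj m
    have h1 := hsp n x
    rw [hx, zero_ap] at h1
    calc x (φ n) = (T' n * T n) * x (φ n) * (T' n * T n) := by rw [hT'T]; simp
      _ = T' n * (T n * x (φ n) * T' n) * T n := by noncomm_ring
      _ = 0 := by rw [← h1]; simp
  · intro y
    choose ψ hψ using hsurj
    have hψ' : ∀ n, ψ (φ n) = n := fun n => hinj (hψ _)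
    refine ⟨mkA (fun m => T' (ψ m) * y (ψ m) * T (ψ m)) (‖Φ‖ * ‖y‖ * ‖Φ‖) (fun m => ?_), ?_⟩
    · refine (norm_mul_le _ _).trans ?_
      refine mul_le_mul ((norm_mul_le _ _).trans ?_) (hTn _) (norm_nonneg _) (by positivity)
      exact mul_le_mul (hT'n _) (norm_ap_le _ _) (norm_nonneg _) Φ.opNorm_nonneg
    · refine ext_ap fun n => ?_
      rw [hsp, mkA_apply, hψ']
      calc _ = (T n * T' n) * y n * (T n * T' n) := by noncomm_ring
        _ = y n := by rw [hTT']; simp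
  · intro x y
    refine ext_ap fun n => ?_
    rw [mul_ap, hsp, hsp, hsp, mul_ap]
    calc _ = T n * x (φ n) * 1 * y (φ n) * T' n := by noncomm_ring
      _ = _ := by rw [← hT'T n]; noncomm_ring

end fin
end TopRefl

/-- Let `H` be a complex separable infinite-dimensional Hilbert space. The
automorphism group of `ℓ∞(ℕ, B(H))` is topologically reflexive: if `Φ` is a bounded
complex-linear map on `ℓ∞(ℕ, B(H))` such that for every `A` the element `Φ(A)` belongs to
the norm-closure of `{Ψ(A) : Ψ an algebra automorphism}`, then `Φ` is itself an algebra
automorphism (a bijective multiplicative complex-linear map). -/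
theorem automorphism_group_topologically_reflexive
    {H : Type*} [NormedAddCommGroup H] [InnerProductSpace ℂ H] [CompleteSpace H]
    [TopologicalSpace.SeparableSpace H] [Nontrivial H]
    (hinf : ¬ FiniteDimensional ℂ H)
    (Φ : lp (fun _ : ℕ => H →L[ℂ] H) ∞ →L[ℂ] lp (fun _ : ℕ => H →L[ℂ] H) ∞)
    (hloc : ∀ x : lp (fun _ : ℕ => H →L[ℂ] H) ∞,
      Φ x ∈ closure {y | ∃ Ψ : lp (fun _ : ℕ => H →L[ℂ] H) ∞ →ₗ[ℂ] lp (fun _ : ℕ => H →L[ℂ] H) ∞,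
        Function.Bijective Ψ ∧ (∀ a b, Ψ (a * b) = Ψ a * Ψ b) ∧ y = Ψ x}) :
    Function.Bijective Φ ∧ ∀ a b, Φ (a * b) = Φ a * Φ b := by
  obtain ⟨b⟩ := TopRefl.exists_basis hinf
  have hΦ : TopRefl.Loc Φ := by
    intro x
    refine closure_mono ?_ (hloc x)
    rintro y ⟨Ψ, h1, h2, h3⟩
    exact ⟨Ψ, ⟨h1, h2⟩, h3⟩
  exact hΦ.main b
end
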